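/- For every integer n ≥ 2, as an identity in the field of rational functions ℚ(x,y) (with the convention Z_0(x,y) = 1), the unrefined ASM generating function satisfies: Z_n(x,y) = Z_{n−1}(x,y)·( 1 + Σ_{i=0}^{n−2} ( y^{i+1}·C(n−1,i+1)² + ( x·y^i·( Σ_{j=0}^{n−i−2} C(n−j−2,i)·Z_{n−i−1}(x,y)_j )² − y^{i+1}·( Σ_{j=0}^{n−i−2} C(n−j−1,i+1)·Z_{n−i−1}(x,y)_j )² ) / ( Z_{n−i−1}(x,y)·Z_{n−i−2}(x,y) ) ) ). -/

import Mathlib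

open Finset

/-- The `n × n` integer matrix encoded by `e`, with entries in `{-1, 0, 1}`. -/
def asmMat {n : ℕ} (e : Fin n → Fin n → Fin 3) : Fin n → Fin n → ℤ :=
  fun i j => (e i j : ℤ) - 1

/-- `A` is an alternating sign matrix: all entries lie in `{-1, 0, 1}`, every
partial row sum and every partial column sum is `0` or `1` (equivalently, the
nonzero entries of each row and of each column alternate in sign), and every
complete row sum and column sum is `1`. -/
def IsASM {n : ℕ} (A : Fin n → Fin n → ℤ) : Prop :=
  (∀ i j, A i j = -1 ∨ A i j = 0 ∨ A i j = 1) ∧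
  (∀ (i j : Fin n), (∑ j' ∈ univ.filter (fun j' : Fin n => j' ≤ j), A i j') = 0 ∨
    (∑ j' ∈ univ.filter (fun j' : Fin n => j' ≤ j), A i j') = 1) ∧
  (∀ (i j : Fin n), (∑ i' ∈ univ.filter (fun i' : Fin n => i' ≤ i), A i' j) = 0 ∨
    (∑ i' ∈ univ.filter (fun i' : Fin n => i' ≤ i), A i' j) = 1) ∧
  (∀ i : Fin n, (∑ j, A i j) = 1) ∧
  (∀ j : Fin n, (∑ i, A i j) = 1)

/-- `ν(A)`, the number of generalized inversions of `A`. -/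
def nuASM {n : ℕ} (A : Fin n → Fin n → ℤ) : ℕ :=
  (∑ i : Fin n, ∑ i' : Fin n, ∑ j : Fin n, ∑ j' : Fin n,
      if i < i' ∧ j' ≤ j then A i j * A i' j' else 0).toNat

/-- `μ(A)`, the number of entries of `A` equal to `-1`. -/
def muASM {n : ℕ} (A : Fin n → Fin n → ℤ) : ℕ :=
  (univ.filter (fun p : Fin n × Fin n => A p.1 p.2 = -1)).card

/-- `ρT(A)`, the number of `0`'s to the left of the `1` in the top row of `A`. -/
def rhoT {n : ℕ} (A : Fin n → Fin n → ℤ) : ℕ :=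
  (univ.filter (fun j : Fin n =>
    A ⟨0, j.pos⟩ j = 0 ∧ ∃ j' : Fin n, j < j' ∧ A ⟨0, j.pos⟩ j' = 1)).card

/-- `ρR(A)`, the number of `0`'s below the `1` in the right-most column of `A`. -/
def rhoR {n : ℕ} (A : Fin n → Fin n → ℤ) : ℕ :=
  (univ.filter (fun i : Fin n =>
    A i ⟨n - 1, Nat.sub_lt i.pos Nat.one_pos⟩ = 0 ∧
      ∃ i' : Fin n, i' < i ∧ A i' ⟨n - 1, Nat.sub_lt i.pos Nat.one_pos⟩ = 1)).card

/-- `ρB(A)`, the number of `0`'s to the right of the `1` in the bottom row of `A`. -/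
def rhoB {n : ℕ} (A : Fin n → Fin n → ℤ) : ℕ :=
  (univ.filter (fun j : Fin n =>
    A ⟨n - 1, Nat.sub_lt j.pos Nat.one_pos⟩ j = 0 ∧
      ∃ j' : Fin n, j' < j ∧ A ⟨n - 1, Nat.sub_lt j.pos Nat.one_pos⟩ j' = 1)).card

/-- `ρL(A)`, the number of `0`'s above the `1` in the left-most column of `A`. -/
def rhoL {n : ℕ} (A : Fin n → Fin n → ℤ) : ℕ :=
  (univ.filter (fun i : Fin n =>
    A i ⟨0, i.pos⟩ = 0 ∧ ∃ i' : Fin n, i < i' ∧ A i' ⟨0, i.pos⟩ = 1)).card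

open Classical in
/-- The quadruply-refined ASM generating function
`Zqua_n(x,y;z1,z2,z3,z4) = Σ_A x^{ν(A)} y^{μ(A)} z1^{ρT(A)} z2^{ρR(A)} z3^{ρB(A)} z4^{ρL(A)}`. -/
noncomputable def Zqua (n : ℕ) {R : Type*} [CommRing R] (x y z1 z2 z3 z4 : R) : R :=
  ∑ e : Fin n → Fin n → Fin 3,
    if IsASM (asmMat e) then
      x ^ nuASM (asmMat e) * y ^ muASM (asmMat e) * z1 ^ rhoT (asmMat e) *
        z2 ^ rhoR (asmMat e) * z3 ^ rhoB (asmMat e) * z4 ^ rhoL (asmMat e)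
    else 0

/-- Adjacent-boundary doubly-refined generating function `Zadj_n(x,y;z1,z2)`. -/
noncomputable def Zadj (n : ℕ) {R : Type*} [CommRing R] (x y z1 z2 : R) : R :=
  Zqua n x y z1 1 1 z2

/-- Alternative adjacent-boundary doubly-refined generating function `Zbaradj_n(x,y;z1,z2)`. -/
noncomputable def Zbaradj (n : ℕ) {R : Type*} [CommRing R] (x y z1 z2 : R) : R :=
  Zqua n x y z1 z2 1 1

/-- Triply-refined generating function `Ztri_n(x,y;z1,z2,z3)`. -/
noncomputable def Ztri (n : ℕ) {R : Type*} [CommRing R] (x y z1 z2 z3 : R) : R :=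
  Zqua n x y z1 1 z2 z3

/-- Opposite-boundary doubly-refined generating function `Zopp_n(x,y;z1,z2)`. -/
noncomputable def Zopp (n : ℕ) {R : Type*} [CommRing R] (x y z1 z2 : R) : R :=
  Zqua n x y z1 1 z2 1

/-- Singly-refined generating function `Z_n(x,y;z)`. -/
noncomputable def Zsing (n : ℕ) {R : Type*} [CommRing R] (x y z : R) : R :=
  Zqua n x y z 1 1 1

/-- Unrefined generating function `Z_n(x,y)`.  Note `Zun 0 x y = 1`. -/
noncomputable def Zun (n : ℕ) {R : Type*} [CommRing R] (x y : R) : R :=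
  Zqua n x y 1 1 1 1

open Classical in
/-- `Z_n(x,y)_k`, the coefficient of `z^k` in the singly-refined generating
function `Z_n(x,y;z)`:  the sum of `x^{ν(A)} y^{μ(A)}` over ASMs `A` of size `n`
with `ρT(A) = k`. -/
noncomputable def Zcoeff (n k : ℕ) {R : Type*} [CommRing R] (x y : R) : R :=
  ∑ e : Fin n → Fin n → Fin 3,
    if IsASM (asmMat e) ∧ rhoT (asmMat e) = k then
      x ^ nuASM (asmMat e) * y ^ muASM (asmMat e)
    else 0

/-- Binomial coefficient with integer arguments, with the convention that
`C(a,b) = 0` unless `0 ≤ b ≤ a`. -/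
def ibinom (a b : ℤ) : ℤ :=
  if 0 ≤ b ∧ b ≤ a then (a.toNat.choose b.toNat : ℤ) else 0

/-- The field of rational functions over `ℚ` in 2 variables. -/
noncomputable abbrev K2 : Type := FractionRing (MvPolynomial (Fin 2) ℚ)

noncomputable def vx : K2 := algebraMap (MvPolynomial (Fin 2) ℚ) K2 (MvPolynomial.X 0)
noncomputable def vy : K2 := algebraMap (MvPolynomial (Fin 2) ℚ) K2 (MvPolynomial.X 1)

set_option linter.all false

/-- The integer `0` or `1` encoded by a Boolean edge state. -/
def edgeVal (b : Bool) : ℤ := if b then 1 else 0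

/-- The six-vertex weight, at spectral parameter `t`, of an entry `a` whose row partial sum to the
left is `h` and whose column partial sum above is `v`; it vanishes on forbidden configurations. -/
def vertexWt {R : Type*} [CommRing R] (q t : R) (h v a : ℤ) : R :=
  if a = 0 ∧ ((h = 0 ∧ v = 0) ∨ (h = 1 ∧ v = 1)) then q ^ 2 * t - 1
  else if a = 0 ∧ ((h = 0 ∧ v = 1) ∨ (h = 1 ∧ v = 0)) then q * (t - 1)
  else if a = 1 ∧ h = 0 ∧ v = 0 then q ^ 2 - 1
  else if a = -1 ∧ h = 1 ∧ v = 1 then (q ^ 2 - 1) * t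
  else 0

/-- The vertex weights as a matrix in the horizontal edge states, for fixed vertical states. -/
def vertexMat {R : Type*} [CommRing R] (q t : R) (a b : Bool) : Matrix Bool Bool R :=
  Matrix.of fun h h' =>
    match a, b, h, h' with
    | false, false, false, false => q ^ 2 * t - 1
    | true, true, true, true => q ^ 2 * t - 1
    | false, false, true, true => q * (t - 1)
    | true, true, false, false => q * (t - 1)
    | false, true, false, true => q ^ 2 - 1
    | true, false, true, false => (q ^ 2 - 1) * t
    | _, _, _, _ => 0

/-- The monodromy of one row of vertices. -/
def monodromy {R : Type*} [CommRing R] (q : R) {n : ℕ} (w : Fin n → R) (u : R)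
    (a b : Fin n → Bool) : Matrix Bool Bool R :=
  (List.ofFn fun j => vertexMat q (u * w j) (a j) (b j)).prod

/-- The row-to-row transfer matrix with domain wall boundary conditions. -/
def rowMat {R : Type*} [CommRing R] (q : R) {n : ℕ} (w : Fin n → R) (u : R) :
    Matrix (Fin n → Bool) (Fin n → Bool) R :=
  Matrix.of fun a b => monodromy q w u a b false true

/-- The intertwiner of two rows of the six-vertex model. -/
def rMat {R : Type*} [CommRing R] (q u v : R) : Matrix (Bool × Bool) (Bool × Bool) R :=
  Matrix.of fun i k =>
    match i, k with
    | (false, false), (false, false) => q ^ 2 * v - u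
    | (true, true), (true, true) => q ^ 2 * v - u
    | (false, true), (false, true) => (q ^ 2 - 1) * u
    | (true, false), (true, false) => (q ^ 2 - 1) * v
    | (false, true), (true, false) => q * (v - u)
    | (true, false), (false, true) => q * (v - u)
    | _, _ => 0

open Matrix Kronecker in
/-- The monodromy of two consecutive rows. -/
def monodromy₂ {R : Type*} [CommRing R] (q : R) {n : ℕ} (w : Fin n → R) (u v : R)
    (a b : Fin n → Bool) : Matrix (Bool × Bool) (Bool × Bool) R :=
  ∑ c : Fin n → Bool, monodromy q w u a c ⊗ₖ monodromy q w v c b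

lemma sum_fin_succ_pi {α M : Type*} [Fintype α] [AddCommMonoid M] {n : ℕ}
    (f : (Fin (n + 1) → α) → M) :
    ∑ c, f c = ∑ x : α, ∑ c : Fin n → α, f (Fin.cons x c) := by
  rw [← Fintype.sum_prod_type' (f := fun x c => f (Fin.cons x c))]
  exact (Fintype.sum_equiv (Fin.consEquiv (fun _ => α)) _ _ fun _ => rfl).symm

lemma monodromy_succ {R : Type*} [CommRing R] (q : R) {n : ℕ} (w : Fin (n + 1) → R) (u : R)
    (a b : Fin (n + 1) → Bool) :
    monodromy q w u a b = vertexMat q (u * w 0) (a 0) (b 0) *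
      monodromy q (Fin.tail w) u (Fin.tail a) (Fin.tail b) := by
  simp [monodromy, List.ofFn_succ, Fin.tail]

open Matrix Kronecker in
lemma monodromy₂_succ {R : Type*} [CommRing R] (q : R) {n : ℕ} (w : Fin (n + 1) → R) (u v : R)
    (a b : Fin (n + 1) → Bool) :
    monodromy₂ q w u v a b =
      (∑ c : Bool, vertexMat q (u * w 0) (a 0) c ⊗ₖ vertexMat q (v * w 0) c (b 0)) *
      monodromy₂ q (Fin.tail w) u v (Fin.tail a) (Fin.tail b) := by
  simp only [monodromy₂]
  rw [sum_fin_succ_pi, Finset.sum_mul]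
  refine Finset.sum_congr rfl fun x _ => ?_
  rw [Finset.mul_sum]
  refine Finset.sum_congr rfl fun c _ => ?_
  rw [monodromy_succ, monodromy_succ, Matrix.mul_kronecker_mul]
  simp

lemma vertexMat_table {R : Type*} [CommRing R] (q t : R) :
    (∀ h, vertexMat q t false true true h = 0) ∧ (∀ h, vertexMat q t true false false h = 0) ∧
    (∀ h, vertexMat q t false true h false = 0) ∧ (∀ h, vertexMat q t true false h true = 0) ∧
    (∀ a, vertexMat q t a a false true = 0) ∧ (∀ a, vertexMat q t a a true false = 0) ∧
    (∀ a, vertexMat q t a a a a = q ^ 2 * t - 1) ∧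
    vertexMat q t false false true true = q * (t - 1) ∧
    vertexMat q t true true false false = q * (t - 1) ∧
    vertexMat q t false true false true = q ^ 2 - 1 ∧
    vertexMat q t true false true false = (q ^ 2 - 1) * t := by
  refine ⟨?_, ?_, ?_, ?_, ?_, ?_, ?_, rfl, rfl, rfl, rfl⟩ <;> intro h <;> cases h <;> rfl

lemma rMat_mul_apply {R : Type*} [CommRing R] (q u v : R) (M : Matrix (Bool × Bool) (Bool × Bool) R)
    (k : Bool × Bool) :
    (rMat q u v * M) (false, false) k = (q ^ 2 * v - u) * M (false, false) k ∧
    (rMat q u v * M) (true, true) k = (q ^ 2 * v - u) * M (true, true) k ∧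
    (rMat q u v * M) (false, true) k =
      (q ^ 2 - 1) * u * M (false, true) k + q * (v - u) * M (true, false) k ∧
    (rMat q u v * M) (true, false) k =
      q * (v - u) * M (false, true) k + (q ^ 2 - 1) * v * M (true, false) k := by
  refine ⟨?_, ?_, ?_, ?_⟩ <;> rw [Matrix.mul_apply, Fintype.sum_prod_type, Fintype.sum_bool,
    Fintype.sum_bool, Fintype.sum_bool] <;> dsimp only [rMat, Matrix.of_apply] <;>
    simp only [zero_mul, add_zero, zero_add]
  all_goals exact add_comm _ _

lemma rMat_transpose {R : Type*} [CommRing R] (q u v : R) : (rMat q u v).transpose = rMat q u v := by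
  ext ⟨_ | _, _ | _⟩ ⟨_ | _, _ | _⟩ <;> rfl

lemma mul_rMat_apply {R : Type*} [CommRing R] (q u v : R) (M : Matrix (Bool × Bool) (Bool × Bool) R)
    (k : Bool × Bool) :
    (M * rMat q u v) k (false, false) = (q ^ 2 * v - u) * M k (false, false) ∧
    (M * rMat q u v) k (true, true) = (q ^ 2 * v - u) * M k (true, true) ∧
    (M * rMat q u v) k (false, true) =
      (q ^ 2 - 1) * u * M k (false, true) + q * (v - u) * M k (true, false) ∧
    (M * rMat q u v) k (true, false) =
      q * (v - u) * M k (false, true) + (q ^ 2 - 1) * v * M k (true, false) := by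
  have h : ∀ l, (M * rMat q u v) k l = (rMat q u v * M.transpose) l k := fun l => by
    rw [← Matrix.transpose_apply (M * _), Matrix.transpose_mul, rMat_transpose]
  simp only [h]
  exact rMat_mul_apply q u v M.transpose k

open Matrix Kronecker in
lemma sum_kronecker_vertexMat_apply {R : Type*} [CommRing R] (q s t : R) (a b : Bool)
    (i k : Bool × Bool) :
    (∑ c : Bool, vertexMat q s a c ⊗ₖ vertexMat q t c b) i k =
      vertexMat q s a true i.1 k.1 * vertexMat q t true b i.2 k.2 +
      vertexMat q s a false i.1 k.1 * vertexMat q t false b i.2 k.2 := by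
  rw [Fintype.sum_bool]
  rfl

open Matrix Kronecker in
lemma rMat_mul_vertex {R : Type*} [CommRing R] (q u v w : R) (a b : Bool) :
    rMat q u v * (∑ c : Bool, vertexMat q (u * w) a c ⊗ₖ vertexMat q (v * w) c b) =
    (∑ c : Bool, vertexMat q (v * w) a c ⊗ₖ vertexMat q (u * w) c b) * rMat q u v := by
  ext ⟨i₁, i₂⟩ ⟨k₁, k₂⟩
  revert a b i₁ i₂ k₁ k₂
  simp only [Bool.forall_bool, rMat_mul_apply, mul_rMat_apply, sum_kronecker_vertexMat_apply,
    vertexMat_table, mul_zero, zero_mul, add_zero, zero_add, true_and, and_true]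
  and_intros <;> ring

lemma rMat_mul_monodromy₂ {R : Type*} [CommRing R] (q u v : R) {n : ℕ} (w : Fin n → R)
    (a b : Fin n → Bool) :
    rMat q u v * monodromy₂ q w u v a b = monodromy₂ q w v u a b * rMat q u v := by
  induction n with
  | zero => simp [monodromy₂, monodromy]
  | succ n ih =>
    rw [monodromy₂_succ, monodromy₂_succ, ← mul_assoc, rMat_mul_vertex, mul_assoc, ih, mul_assoc]

lemma rowMat_commute {R : Type*} [CommRing R] [IsDomain R] {q u v : R} (h : q ^ 2 * v - u ≠ 0)
    {n : ℕ} (w : Fin n → R) : Commute (rowMat q w u) (rowMat q w v) := by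
  ext a b
  have := congrFun (congrFun (rMat_mul_monodromy₂ q u v w a b) (false, false)) (true, true)
  rw [(rMat_mul_apply q u v _ _).1, (mul_rMat_apply q u v _ _).2.1] at this
  have hmul : ∀ u v : R, (rowMat q w u * rowMat q w v) a b =
      monodromy₂ q w u v a b (false, false) (true, true) := fun u v => by
    rw [Matrix.mul_apply, monodromy₂, Matrix.sum_apply]
    rfl
  rw [hmul, hmul]
  exact mul_left_cancel₀ h this

/-- The sum of the values of `f` at the indices below `j`. -/
def psum {n : ℕ} (f : Fin n → ℤ) (j : Fin n) : ℤ := ∑ j', if j' < j then f j' else 0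

@[simp] lemma psum_zero {n : ℕ} (f : Fin (n + 1) → ℤ) : psum f 0 = 0 := by simp [psum]

@[simp] lemma psum_succ {n : ℕ} (f : Fin (n + 1) → ℤ) (j : Fin n) :
    psum f j.succ = f 0 + psum (Fin.tail f) j := by
  simp [psum, Fin.sum_univ_succ, Fin.tail]

lemma vertexMat_apply {R : Type*} [CommRing R] (q t : R) (a b h h' : Bool) :
    vertexMat q t a b h h' = if edgeVal h' = edgeVal h + (edgeVal b - edgeVal a) then
      vertexWt q t (edgeVal h) (edgeVal a) (edgeVal b - edgeVal a) else 0 := by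
  cases a <;> cases b <;> cases h <;> cases h' <;> rfl

lemma vertexWt_eq_zero {R : Type*} [CommRing R] (q t : R) (h v a : ℤ)
    (hh : ∀ k : Bool, edgeVal k ≠ h + a) : vertexWt q t h v a = 0 := by
  have h0 := hh false
  have h1 := hh true
  simp only [edgeVal, Bool.false_eq_true, if_false, if_true] at h0 h1
  unfold vertexWt
  rw [if_neg (by omega), if_neg (by omega), if_neg (by omega), if_neg (by omega)]

lemma edgeVal_injective : Function.Injective edgeVal := by decide

lemma monodromy_apply {R : Type*} [CommRing R] (q : R) {n : ℕ} (w : Fin n → R) (u : R)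
    (a b : Fin n → Bool) (h h' : Bool) :
    monodromy q w u a b h h' =
      if edgeVal h' = edgeVal h + ∑ j, (edgeVal (b j) - edgeVal (a j)) then
        ∏ j, vertexWt q (u * w j) (edgeVal h + psum (fun j => edgeVal (b j) - edgeVal (a j)) j)
          (edgeVal (a j)) (edgeVal (b j) - edgeVal (a j))
      else 0 := by
  induction n generalizing h with
  | zero => cases h <;> cases h' <;> rfl
  | succ n ih =>
    rw [monodromy_succ, Matrix.mul_apply]
    simp only [ih, vertexMat_apply, Fin.sum_univ_succ, Fin.prod_univ_succ, psum_succ, psum_zero,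
      ← add_assoc, add_zero]
    by_cases hk : ∃ k, edgeVal k = edgeVal h + (edgeVal (b 0) - edgeVal (a 0))
    · obtain ⟨k, hk⟩ := hk
      simp only [← hk]
      rw [Finset.sum_eq_single k]
      · rw [if_pos rfl, mul_ite, mul_zero]
        rfl
      · intro c _ hc
        rw [if_neg fun hck => hc (edgeVal_injective hck), zero_mul]
      · exact fun hk => absurd (Finset.mem_univ _) hk
    · push Not at hk
      rw [vertexWt_eq_zero _ _ _ _ _ hk, zero_mul, ite_self]
      exact Finset.sum_eq_zero fun c _ => by rw [if_neg (hk c), zero_mul]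

/-- The product of vertex weights over a rectangular matrix `A` whose column partial sums start
from `a`. -/
def gridWt {R : Type*} [CommRing R] (q : R) {m n : ℕ} (u : Fin m → R) (w : Fin n → R)
    (a : Fin n → ℤ) (A : Fin m → Fin n → ℤ) : R :=
  ∏ i, ∏ j, vertexWt q (u i * w j) (psum (A i) j) (a j + psum (fun i' => A i' j) i) (A i j)

/-- The integer in `{-1, 0, 1}` encoded by an element of `Fin 3`. -/
def entryVal (t : Fin 3) : ℤ := (t : ℤ) - 1

/-- Fields of `{-1, 0, 1}`-valued integers with given column states have row encoding `c - a`. -/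
def entryOf (a c : Bool) : Fin 3 :=
  match a, c with
  | false, true => 2
  | true, false => 0
  | _, _ => 1

lemma entryVal_entryOf (a c : Bool) : entryVal (entryOf a c) = edgeVal c - edgeVal a := by
  cases a <;> cases c <;> rfl

lemma entryOf_injective (a : Bool) : Function.Injective (entryOf a) := by
  cases a <;> decide

lemma eq_entryOf {a : Bool} {t : Fin 3} {k : Bool} (h : edgeVal k = edgeVal a + entryVal t) :
    t = entryOf a k := by
  revert a t k
  decide

lemma vertexWt_eq_zero' {R : Type*} [CommRing R] (q t : R) (h v a : ℤ)
    (hh : ∀ k : Bool, edgeVal k ≠ v + a) : vertexWt q t h v a = 0 := by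
  have h0 := hh false
  have h1 := hh true
  simp only [edgeVal, Bool.false_eq_true, if_false, if_true] at h0 h1
  unfold vertexWt
  rw [if_neg (by omega), if_neg (by omega), if_neg (by omega), if_neg (by omega)]

lemma gridWt_succ {R : Type*} [CommRing R] (q : R) {m n : ℕ} (u : Fin (m + 1) → R) (w : Fin n → R)
    (a : Fin n → ℤ) (A : Fin (m + 1) → Fin n → ℤ) :
    gridWt q u w a A = (∏ j, vertexWt q (u 0 * w j) (psum (A 0) j) (a j) (A 0 j)) *
      gridWt q (Fin.tail u) w (fun j => a j + A 0 j) (Fin.tail A) := by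
  simp only [gridWt, Fin.prod_univ_succ, psum_zero, add_zero, psum_succ, Fin.tail_def, add_assoc]

lemma rowMat_apply {R : Type*} [CommRing R] (q : R) {n : ℕ} (w : Fin n → R) (u : R)
    (a b : Fin n → Bool) :
    rowMat q w u a b = if ∑ j, entryVal (entryOf (a j) (b j)) = 1 then
      ∏ j, vertexWt q (u * w j) (psum (fun j => entryVal (entryOf (a j) (b j))) j)
        (edgeVal (a j)) (entryVal (entryOf (a j) (b j))) else 0 := by
  simp only [rowMat, Matrix.of_apply, monodromy_apply, entryVal_entryOf]
  have e1 : edgeVal true = 1 := rfl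
  have e0 : edgeVal false = 0 := rfl
  simp only [e1, e0, zero_add, eq_comm (a := (1 : ℤ))]

lemma sum_rowMat_mul {R : Type*} [CommRing R] (q : R) {n : ℕ} (w : Fin n → R) (u : R)
    (a : Fin n → Bool) (G : (Fin n → ℤ) → R) :
    ∑ r : Fin n → Fin 3, (if ∑ j, entryVal (r j) = 1 then
      (∏ j, vertexWt q (u * w j) (psum (fun j => entryVal (r j)) j) (edgeVal (a j))
        (entryVal (r j))) else 0) * G (fun j => edgeVal (a j) + entryVal (r j)) =
    ∑ c : Fin n → Bool, rowMat q w u a c * G (fun j => edgeVal (c j)) := by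
  symm
  refine Fintype.sum_of_injective (fun c j => entryOf (a j) (c j)) ?_ _ _ ?_ ?_
  · intro c c' h
    funext j
    exact entryOf_injective _ (congrFun h j)
  · intro r hr
    have : ∃ j, ∀ k : Bool, edgeVal k ≠ edgeVal (a j) + entryVal (r j) := by
      by_contra! hc
      choose k hk using hc
      exact hr ⟨k, funext fun j => (eq_entryOf (hk j)).symm⟩
    obtain ⟨j, hj⟩ := this
    rw [Finset.prod_eq_zero (Finset.mem_univ j) (vertexWt_eq_zero' _ _ _ _ _ hj)]
    simp
  · intro c
    rw [rowMat_apply]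
    congr 2
    funext j
    rw [entryVal_entryOf]
    ring

lemma list_prod_rowMat {R : Type*} [CommRing R] (q : R) {m n : ℕ} (u : Fin m → R) (w : Fin n → R)
    (a b : Fin n → Bool) :
    (List.ofFn fun i => rowMat q w (u i)).prod a b =
    ∑ e : Fin m → Fin n → Fin 3,
      if (∀ i, ∑ j, entryVal (e i j) = 1) ∧
          (∀ j, edgeVal (a j) + ∑ i, entryVal (e i j) = edgeVal (b j)) then
        gridWt q u w (fun j => edgeVal (a j)) (fun i j => entryVal (e i j)) else 0 := by
  induction m generalizing a with
  | zero =>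
    have : (∀ j, edgeVal (a j) = edgeVal (b j)) ↔ a = b :=
      ⟨fun h => funext fun j => edgeVal_injective (h j), fun h j => by rw [h]⟩
    simp [gridWt, Matrix.one_apply, this]
  | succ m ih =>
    rw [List.ofFn_succ, List.prod_cons, Matrix.mul_apply, sum_fin_succ_pi]
    have key := sum_rowMat_mul q w (u 0) a (fun c => ∑ e : Fin m → Fin n → Fin 3,
      if (∀ i, ∑ j, entryVal (e i j) = 1) ∧
          (∀ j, c j + ∑ i, entryVal (e i j) = edgeVal (b j)) then
        gridWt q (Fin.tail u) w c (fun i j => entryVal (e i j)) else 0)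
    have h1 : ∀ c, (List.ofFn fun i : Fin m => rowMat q w (u i.succ)).prod c b = _ :=
      fun c => ih (Fin.tail u) c
    simp only [h1]
    rw [← key]
    refine Finset.sum_congr rfl fun r _ => ?_
    rw [Finset.mul_sum]
    refine Finset.sum_congr rfl fun e _ => ?_
    simp only [Fin.forall_fin_succ, Fin.cons_zero, Fin.cons_succ, Fin.sum_univ_succ, gridWt_succ,
      ← add_assoc]
    rw [ite_zero_mul_ite_zero]
    refine if_congr (by tauto) ?_ rfl
    rfl

open Classical in
/-- The partition function of the inhomogeneous six-vertex model with domain wall boundary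
conditions, as a sum over alternating sign matrices. -/
noncomputable def inhomZ {R : Type*} [CommRing R] (q : R) {n : ℕ} (u w : Fin n → R) : R :=
  ∑ e : Fin n → Fin n → Fin 3,
    if IsASM (asmMat e) then gridWt q u w (fun _ => 0) (asmMat e) else 0

lemma sum_filter_le {n : ℕ} (f : Fin n → ℤ) (j : Fin n) :
    ∑ j' ∈ univ.filter (fun j' : Fin n => j' ≤ j), f j' = psum f j + f j := by
  have h : univ.filter (fun j' : Fin n => j' ≤ j) = insert j (univ.filter fun j' => j' < j) := by
    ext k
    simp [le_iff_lt_or_eq, or_comm]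
  rw [h, Finset.sum_insert (by simp), add_comm, Finset.sum_filter]
  rfl

lemma exists_edgeVal {R : Type*} [CommRing R] {q t : R} {h v a : ℤ} (hw : vertexWt q t h v a ≠ 0) :
    (∃ k : Bool, edgeVal k = h + a) ∧ ∃ k : Bool, edgeVal k = v + a := by
  constructor <;> by_contra! hc
  · exact hw (vertexWt_eq_zero _ _ _ _ _ hc)
  · exact hw (vertexWt_eq_zero' _ _ _ _ _ hc)

lemma edgeVal_eq (k : Bool) : edgeVal k = 0 ∨ edgeVal k = 1 := by cases k <;> simp [edgeVal]

lemma asmMat_mem {n : ℕ} (e : Fin n → Fin n → Fin 3) (i j : Fin n) :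
    asmMat e i j = -1 ∨ asmMat e i j = 0 ∨ asmMat e i j = 1 := by
  unfold asmMat
  generalize e i j = t
  revert t
  decide

lemma isASM_of_gridWt_ne_zero {R : Type*} [CommRing R] {q : R} {n : ℕ} {u w : Fin n → R}
    {e : Fin n → Fin n → Fin 3} (hr : ∀ i, ∑ j, asmMat e i j = 1) (hc : ∀ j, ∑ i, asmMat e i j = 1)
    (hw : gridWt q u w (fun _ => 0) (asmMat e) ≠ 0) : IsASM (asmMat e) := by
  have hij : ∀ i j, vertexWt q (u i * w j) (psum (asmMat e i) j)
      (0 + psum (fun i' => asmMat e i' j) i) (asmMat e i j) ≠ 0 := fun i j h =>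
    hw (Finset.prod_eq_zero (Finset.mem_univ i) (Finset.prod_eq_zero (Finset.mem_univ j) h))
  refine ⟨asmMat_mem e, fun i j => ?_, fun i j => ?_, hr, hc⟩
  · obtain ⟨⟨k, hk⟩, -⟩ := exists_edgeVal (hij i j)
    rw [sum_filter_le, ← hk]
    exact edgeVal_eq k
  · obtain ⟨-, ⟨k, hk⟩⟩ := exists_edgeVal (hij i j)
    rw [sum_filter_le (fun i' => asmMat e i' j), ← zero_add (psum _ _), ← hk]
    exact edgeVal_eq k

lemma inhomZ_eq_list_prod {R : Type*} [CommRing R] (q : R) {n : ℕ} (u w : Fin n → R) :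
    inhomZ q u w = (List.ofFn fun i => rowMat q w (u i)).prod (fun _ => false) fun _ => true := by
  classical
  rw [list_prod_rowMat, inhomZ]
  refine Finset.sum_congr rfl fun e _ => ?_
  have e1 : edgeVal true = 1 := rfl
  have e0 : edgeVal false = 0 := rfl
  simp only [e1, e0, zero_add]
  by_cases hA : IsASM (asmMat e)
  · rw [if_pos hA, if_pos ⟨hA.2.2.2.1, hA.2.2.2.2⟩]
    rfl
  · rw [if_neg hA]
    split_ifs with ht
    · by_contra hw
      exact hA (isASM_of_gridWt_ne_zero ht.1 ht.2 (Ne.symm hw))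
    · rfl

lemma inhomZ_comp_perm {R : Type*} [CommRing R] [IsDomain R] (q : R) {n : ℕ} (u w : Fin n → R)
    (hu : ∀ i j, i ≠ j → q ^ 2 * u j - u i ≠ 0) (σ : Equiv.Perm (Fin n)) :
    inhomZ q (u ∘ σ) w = inhomZ q u w := by
  rw [inhomZ_eq_list_prod, inhomZ_eq_list_prod]
  have hp : (List.ofFn fun i => rowMat q w ((u ∘ σ) i)).Perm
      (List.ofFn fun i => rowMat q w (u i)) :=
    Equiv.Perm.ofFn_comp_perm σ fun i => rowMat q w (u i)
  have hc : (List.ofFn fun i => rowMat q w ((u ∘ σ) i)).Pairwise Commute := by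
    rw [List.pairwise_ofFn]
    intro i j hij
    exact rowMat_commute (hu _ _ fun h => hij.ne (σ.injective h)) w
  rw [hp.prod_eq' hc]

lemma isASM_iff {n : ℕ} {A : Fin n → Fin n → ℤ} : IsASM A ↔
    (∀ i j, A i j = -1 ∨ A i j = 0 ∨ A i j = 1) ∧
    (∀ i j, psum (A i) j + A i j = 0 ∨ psum (A i) j + A i j = 1) ∧
    (∀ i j, psum (fun i' => A i' j) i + A i j = 0 ∨ psum (fun i' => A i' j) i + A i j = 1) ∧
    (∀ i, ∑ j, A i j = 1) ∧ ∀ j, ∑ i, A i j = 1 := by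
  unfold IsASM
  simp only [sum_filter_le]

lemma psum_mem {n : ℕ} {f : Fin n → ℤ} (hf : ∀ j, psum f j + f j = 0 ∨ psum f j + f j = 1)
    (j : Fin n) : psum f j = 0 ∨ psum f j = 1 := by
  obtain ⟨j, hj⟩ := j
  cases j with
  | zero =>
    left
    simp [psum, Fin.lt_def]
  | succ k =>
    have hk := hf ⟨k, by omega⟩
    rw [← sum_filter_le, Finset.sum_filter] at hk
    have : psum f ⟨k + 1, hj⟩ = ∑ a, if a ≤ ⟨k, by omega⟩ then f a else 0 := by
      refine Finset.sum_congr rfl fun a _ => ?_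
      simp [Fin.lt_def, Fin.le_def]
    rwa [this]

lemma exists_eq_single {n : ℕ} {f : Fin n → ℤ} (hf : ∀ j, f j = 0 ∨ f j = 1) (hs : ∑ j, f j = 1) :
    ∃ p, f = Pi.single p 1 := by
  obtain ⟨p, -, hp⟩ := Finset.exists_ne_zero_of_sum_ne_zero (s := univ) (f := f) (by omega)
  have hp1 : f p = 1 := (hf p).resolve_left hp
  refine ⟨p, funext fun j => ?_⟩
  by_cases hj : j = p
  · subst hj
    simp [hp1]
  · rw [Pi.single_eq_of_ne hj]
    rw [← Finset.add_sum_erase _ _ (Finset.mem_univ p), hp1] at hs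
    have h0 : ∑ x ∈ univ.erase p, f x = 0 := by omega
    refine (Finset.sum_eq_zero_iff_of_nonneg fun i _ => ?_).1 h0 j (by simp [hj])
    rcases hf i with h | h <;> omega

lemma IsASM.exists_row {n : ℕ} {A : Fin (n + 1) → Fin (n + 1) → ℤ} (hA : IsASM A) :
    ∃ p, A 0 = Pi.single p 1 := by
  rw [isASM_iff] at hA
  refine exists_eq_single (fun j => ?_) (hA.2.2.2.1 0)
  simpa using hA.2.2.1 0 j

lemma IsASM.transpose {n : ℕ} {A : Fin n → Fin n → ℤ} (hA : IsASM A) :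
    IsASM fun i j => A j i := by
  rw [isASM_iff] at hA ⊢
  exact ⟨fun i j => hA.1 j i, fun i j => hA.2.2.1 j i, fun i j => hA.2.1 j i, hA.2.2.2.2,
    hA.2.2.2.1⟩

lemma IsASM.exists_col {n : ℕ} {A : Fin (n + 1) → Fin (n + 1) → ℤ} (hA : IsASM A) :
    ∃ p, (fun i => A i 0) = Pi.single p 1 :=
  hA.transpose.exists_row

/-- The block sum of the `1 × 1` identity matrix and `A`. -/
def cornerMat {n : ℕ} {R : Type*} (z o : R) (A : Fin n → Fin n → R) :
    Fin (n + 1) → Fin (n + 1) → R :=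
  Fin.cons (Fin.cons o fun _ => z) fun i => Fin.cons z (A i)

lemma asmMat_cornerMat {n : ℕ} (e : Fin n → Fin n → Fin 3) :
    asmMat (cornerMat 1 2 e) = cornerMat 0 1 (asmMat e) := by
  funext i j
  cases i using Fin.cases <;> cases j using Fin.cases <;> simp [asmMat, cornerMat]

@[simp] lemma psum_zero_fun {n : ℕ} (j : Fin n) : psum (fun _ => 0) j = 0 := by
  simp [psum]

lemma isASM_cornerMat {n : ℕ} {A : Fin n → Fin n → ℤ} : IsASM (cornerMat 0 1 A) ↔ IsASM A := by
  rw [isASM_iff, isASM_iff]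
  simp only [cornerMat, Int.reduceNeg, Fin.forall_fin_succ, Fin.cons_zero, reduceCtorEq,
    one_ne_zero, or_true, Fin.cons_succ, zero_eq_neg, zero_ne_one, or_false, implies_true,
    and_self, true_and, psum_zero, zero_add, psum_succ, Fin.tail_def, psum_zero_fun, add_zero,
    Fin.sum_univ_succ, sum_const_zero]

lemma cornerMat_injective {n : ℕ} {R : Type*} (z o : R) :
    Function.Injective (cornerMat (n := n) z o) := by
  intro A B h
  funext i j
  simpa [cornerMat] using congrFun (congrFun h i.succ) j.succ

lemma asmMat_injective {n : ℕ} : Function.Injective (asmMat (n := n)) := by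
  intro e e' h
  funext i j
  have := congrFun (congrFun h i) j
  simp only [asmMat] at this
  omega

lemma IsASM.exists_cornerMat {n : ℕ} {e : Fin (n + 1) → Fin (n + 1) → Fin 3}
    (hA : IsASM (asmMat e)) (h0 : asmMat e 0 0 ≠ 0) : ∃ e', cornerMat 1 2 e' = e := by
  refine ⟨fun i j => e i.succ j.succ, asmMat_injective ?_⟩
  rw [asmMat_cornerMat]
  obtain ⟨p, hp⟩ := hA.exists_row
  obtain ⟨p', hp'⟩ := hA.exists_col
  have hp0 : p = 0 := by
    by_contra hp0
    exact h0 (by rw [hp, Pi.single_eq_of_ne (Ne.symm hp0)])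
  have hp0' : p' = 0 := by
    by_contra hp0'
    exact h0 ((congrFun hp' 0).trans (Pi.single_eq_of_ne (Ne.symm hp0') 1))
  subst hp0 hp0'
  funext i j
  cases i using Fin.cases with
  | zero => cases j using Fin.cases <;> simp [cornerMat, hp]
  | succ i =>
    cases j using Fin.cases with
    | zero => simpa [cornerMat] using (congrFun hp' i.succ).symm
    | succ j => rfl

open Classical in
lemma sum_isASM_succ {M : Type*} [AddCommMonoid M] {n : ℕ}
    (F : (Fin (n + 1) → Fin (n + 1) → ℤ) → M) :
    (∑ e : Fin (n + 1) → Fin (n + 1) → Fin 3, if IsASM (asmMat e) then F (asmMat e) else 0) =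
      (∑ e : Fin n → Fin n → Fin 3,
        if IsASM (asmMat e) then F (cornerMat 0 1 (asmMat e)) else 0) +
      ∑ e : Fin (n + 1) → Fin (n + 1) → Fin 3,
        if IsASM (asmMat e) ∧ asmMat e 0 0 = 0 then F (asmMat e) else 0 := by
  have h1 : (∑ e : Fin n → Fin n → Fin 3,
      if IsASM (asmMat e) then F (cornerMat 0 1 (asmMat e)) else 0) =
      ∑ e : Fin (n + 1) → Fin (n + 1) → Fin 3,
        if IsASM (asmMat e) ∧ asmMat e 0 0 ≠ 0 then F (asmMat e) else 0 := by
    refine Finset.sum_of_injOn (cornerMat 1 2) (cornerMat_injective 1 2).injOn (by simp) ?_ ?_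
    · intro e _ he
      rw [if_neg]
      rintro ⟨h, h0⟩
      obtain ⟨e', rfl⟩ := h.exists_cornerMat h0
      simp at he
    · intro e _
      simp only [asmMat_cornerMat, isASM_cornerMat]
      simp [cornerMat]
  rw [h1, ← Finset.sum_add_distrib]
  refine Finset.sum_congr rfl fun e _ => ?_
  by_cases h : IsASM (asmMat e) <;> by_cases h0 : asmMat e 0 0 = 0 <;> simp [h, h0]

@[simp] lemma vertexWt_zero_zero_zero {R : Type*} [CommRing R] (q t : R) :
    vertexWt q t 0 0 0 = q ^ 2 * t - 1 := by simp [vertexWt]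

@[simp] lemma vertexWt_zero_zero_one {R : Type*} [CommRing R] (q t : R) :
    vertexWt q t 0 0 1 = q ^ 2 - 1 := by simp [vertexWt]

@[simp] lemma vertexWt_one_zero_zero {R : Type*} [CommRing R] (q t : R) :
    vertexWt q t 1 0 0 = q * (t - 1) := by simp [vertexWt]

@[simp] lemma vertexWt_zero_one_zero {R : Type*} [CommRing R] (q t : R) :
    vertexWt q t 0 1 0 = q * (t - 1) := by simp [vertexWt]

lemma gridWt_cornerMat {R : Type*} [CommRing R] (q : R) {n : ℕ} (u w : Fin (n + 1) → R)
    (A : Fin n → Fin n → ℤ) :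
    gridWt q u w (fun _ => 0) (cornerMat 0 1 A) =
      (q ^ 2 - 1) * (∏ j, q * (u 0 * Fin.tail w j - 1)) * (∏ i, q * (Fin.tail u i * w 0 - 1)) *
        gridWt q (Fin.tail u) (Fin.tail w) (fun _ => 0) A := by
  simp only [gridWt, Fin.prod_univ_succ, cornerMat, Fin.cons_zero, Fin.cons_succ, psum_zero,
    psum_succ, Fin.tail_def, zero_add, psum_zero_fun, add_zero, Finset.prod_mul_distrib,
    vertexWt_zero_zero_one, vertexWt_one_zero_zero, vertexWt_zero_one_zero]
  ring

lemma inhomZ_succ {R : Type*} [CommRing R] (q : R) {n : ℕ} (u w : Fin (n + 1) → R)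
    (h : q ^ 2 * (u 0 * w 0) - 1 = 0) :
    inhomZ q u w = (q ^ 2 - 1) * (∏ j, q * (u 0 * Fin.tail w j - 1)) *
      (∏ i, q * (Fin.tail u i * w 0 - 1)) * inhomZ q (Fin.tail u) (Fin.tail w) := by
  classical
  rw [inhomZ, sum_isASM_succ (F := gridWt q u w fun _ => 0), inhomZ, Finset.mul_sum,
    add_eq_left.2]
  · simp only [gridWt_cornerMat, mul_ite, mul_zero]
  · refine Finset.sum_eq_zero fun e _ => ?_
    split_ifs with he
    · refine Finset.prod_eq_zero (Finset.mem_univ 0) (Finset.prod_eq_zero (Finset.mem_univ 0) ?_)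
      simp [he.2, h]
    · rfl

lemma vertexWt_comm {R : Type*} [CommRing R] (q t : R) (h v a : ℤ) :
    vertexWt q t h v a = vertexWt q t v h a := by
  simp only [vertexWt, and_comm, or_comm]

lemma map_vertexWt {R S : Type*} [CommRing R] [CommRing S] (f : R →+* S) (q t : R) (h v a : ℤ) :
    f (vertexWt q t h v a) = vertexWt (f q) (f t) h v a := by
  simp only [vertexWt, apply_ite f, map_sub, map_mul, map_pow, map_one, map_zero]

lemma map_inhomZ {R S : Type*} [CommRing R] [CommRing S] (f : R →+* S) (q : R) {n : ℕ}
    (u w : Fin n → R) : f (inhomZ q u w) = inhomZ (f q) (f ∘ u) (f ∘ w) := by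
  simp only [inhomZ, gridWt, map_sum, apply_ite f, map_prod, map_vertexWt, map_zero, map_mul,
    Function.comp]

lemma inhomZ_comm {R : Type*} [CommRing R] (q : R) {n : ℕ} (u w : Fin n → R) :
    inhomZ q u w = inhomZ q w u := by
  classical
  refine Fintype.sum_equiv (Equiv.piComm _) _ _ fun e => ?_
  have h : IsASM (asmMat e) ↔ IsASM (asmMat (Equiv.piComm (fun _ _ => Fin 3) e)) :=
    ⟨fun h => h.transpose, fun h => h.transpose⟩
  refine if_congr h ?_ rfl
  unfold gridWt
  rw [Finset.prod_comm]
  refine Finset.prod_congr rfl fun j _ => Finset.prod_congr rfl fun i _ => ?_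
  rw [vertexWt_comm, mul_comm (u i), zero_add, zero_add]
  rfl

open Polynomial in
lemma natDegree_vertexWt_le {R : Type*} [CommRing R] (q u : R) (h v a : ℤ) :
    (vertexWt (C q) (C u * X) h v a).natDegree ≤ if a = 1 then 0 else 1 := by
  unfold vertexWt
  have hc : (C q ^ 2 - 1 : R[X]) = C (q ^ 2 - 1) := by simp
  rw [hc]
  split_ifs <;> try omega
  all_goals compute_degree
  all_goals omega

open Polynomial in
lemma natDegree_gridWt_le {F : Type*} [Field F] (q : F) {n : ℕ} (u : Fin (n + 1) → F)
    (w : Fin n → F) {e : Fin (n + 1) → Fin (n + 1) → Fin 3} (he : IsASM (asmMat e)) :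
    (gridWt (C q) (fun i => C (u i)) (Fin.cons X fun j => C (w j)) (fun _ => 0)
      (asmMat e)).natDegree ≤ n := by
  obtain ⟨p, hp⟩ := he.exists_col
  have h0 : ∀ i, (∏ j, vertexWt (C q)
      (C (u i) * (Fin.cons X fun j => C (w j) : Fin (n + 1) → F[X]) j)
      (psum (asmMat e i) j) (0 + psum (fun i' => asmMat e i' j) i) (asmMat e i j)).natDegree ≤
      if i = p then 0 else 1 := by
    intro i
    rw [Fin.prod_univ_succ]
    refine natDegree_mul_le.trans ?_
    have h2 : (∏ j : Fin n, vertexWt (C q) (C (u i) *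
        (Fin.cons X fun j => C (w j) : Fin (n + 1) → F[X]) j.succ) (psum (asmMat e i) j.succ)
          (0 + psum (fun i' => asmMat e i' j.succ) i) (asmMat e i j.succ)).natDegree = 0 := by
      have : ∀ j : Fin n, vertexWt (C q) (C (u i) *
        (Fin.cons X fun j => C (w j) : Fin (n + 1) → F[X]) j.succ) (psum (asmMat e i) j.succ)
          (0 + psum (fun i' => asmMat e i' j.succ) i) (asmMat e i j.succ) =
          C (vertexWt q (u i * w j) (psum (asmMat e i) j.succ)
          (0 + psum (fun i' => asmMat e i' j.succ) i) (asmMat e i j.succ)) := by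
        intro j
        rw [Fin.cons_succ, ← C_mul, map_vertexWt]
      rw [Finset.prod_congr rfl fun j _ => this j, ← map_prod, natDegree_C]
    rw [h2, add_zero]
    refine (natDegree_vertexWt_le _ _ _ _ _).trans_eq ?_
    have hpi : asmMat e i 0 = (Pi.single p 1 : Fin (n + 1) → ℤ) i := congrFun hp i
    rw [hpi]
    by_cases hi : i = p
    · subst hi; simp
    · simp [hi]
  refine (natDegree_prod_le _ _).trans ((Finset.sum_le_sum fun i _ => h0 i).trans ?_)
  rw [Finset.sum_ite]
  simp [Finset.filter_ne']

open Polynomial in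
lemma exists_poly_inhomZ {F : Type*} [Field F] (q : F) {n : ℕ} (u : Fin (n + 1) → F)
    (w : Fin n → F) :
    ∃ p : F[X], p.natDegree ≤ n ∧ ∀ x, p.eval x = inhomZ q u (Fin.cons x w) := by
  refine ⟨inhomZ (C q) (fun i => C (u i)) (Fin.cons X fun j => C (w j)), ?_, fun x => ?_⟩
  · refine natDegree_sum_le_of_forall_le _ _ fun e _ => ?_
    split_ifs with he
    · exact natDegree_gridWt_le q u w he
    · simp
  · have h := map_inhomZ (evalRingHom x) (C q) (fun i => C (u i)) (Fin.cons X fun j => C (w j))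
    have h1 : (evalRingHom x ∘ fun i => C (u i)) = u := by
      funext i
      simp
    have h2 : (evalRingHom x ∘ (Fin.cons X fun j => C (w j) : Fin (n + 1) → F[X])) =
        Fin.cons x w := by
      funext j
      cases j using Fin.cases <;> simp
    rw [h1, h2] at h
    simpa using h

/-- The product of the two weights of the zero entries at spectral parameter `t`. -/
def zeroWt {R : Type*} [CommRing R] (q t : R) : R := (q ^ 2 * t - 1) * (q * (t - 1))

/-- The Izergin–Korepin matrix. -/
def ikMat {F : Type*} [Field F] (q : F) {m n : ℕ} (u : Fin m → F) (w : Fin n → F) :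
    Matrix (Fin m) (Fin n) F :=
  Matrix.of fun i j => (q ^ 2 - 1) / zeroWt q (u i * w j)

/-- The Izergin–Korepin matrix whose first column has been cleared of denominators. -/
def ikMat' {F : Type*} [Field F] (q : F) {n : ℕ} (u : Fin (n + 1) → F) (x : F) (w : Fin n → F) :
    Matrix (Fin (n + 1)) (Fin (n + 1)) F :=
  Matrix.of fun i => Fin.cons ((q ^ 2 - 1) * ∏ k ∈ univ.erase i, zeroWt q (u k * x))
    (ikMat q u w i)

lemma det_ikMat' {F : Type*} [Field F] (q : F) {n : ℕ} (u : Fin (n + 1) → F) (x : F)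
    (w : Fin n → F) (h : ∀ i, zeroWt q (u i * x) ≠ 0) :
    (ikMat' q u x w).det = (∏ i, zeroWt q (u i * x)) * (ikMat q u (Fin.cons x w)).det := by
  have : ikMat' q u x w = (ikMat q u (Fin.cons x w)).updateCol 0
      ((∏ i, zeroWt q (u i * x)) • fun i => ikMat q u (Fin.cons x w) i 0) := by
    ext i j
    cases j using Fin.cases with
    | zero =>
      rw [Matrix.updateCol_self]
      simp only [ikMat', ikMat, Matrix.of_apply, Fin.cons_zero, Pi.smul_apply, smul_eq_mul]
      rw [← Finset.mul_prod_erase _ _ (Finset.mem_univ i)]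
      rw [mul_div_assoc', eq_div_iff (h i)]
      ring
    | succ j =>
      rw [Matrix.updateCol_ne (Fin.succ_ne_zero j)]
      simp [ikMat', ikMat]
  rw [this, Matrix.det_updateCol_smul, Matrix.updateCol_eq_self]

lemma det_vandermonde_cons {R : Type*} [CommRing R] {n : ℕ} (x : R) (w : Fin n → R) :
    (Matrix.vandermonde (Fin.cons x w : Fin (n + 1) → R)).det =
      (∏ j, (w j - x)) * (Matrix.vandermonde w).det := by
  rw [Matrix.det_vandermonde, Matrix.det_vandermonde, Fin.prod_univ_succ, Fin.prod_Ioi_zero]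
  simp [Fin.prod_Ioi_succ]

open Polynomial in
lemma exists_poly_ikMat' {F : Type*} [Field F] (q : F) {n : ℕ} (u : Fin (n + 1) → F)
    (w : Fin n → F) :
    ∃ p : F[X], p.natDegree ≤ 2 * n ∧ ∀ x, p.eval x = (ikMat' q u x w).det := by
  refine ⟨∑ i : Fin (n + 1), C ((-1) ^ (i : ℕ) * (q ^ 2 - 1) *
    ((ikMat q u w).submatrix i.succAbove id).det) *
      ∏ k ∈ univ.erase i, zeroWt (C q) (C (u k) * X), ?_, fun x => ?_⟩
  · refine natDegree_sum_le_of_forall_le _ _ fun i _ => ?_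
    refine (natDegree_C_mul_le _ _).trans ((natDegree_prod_le _ _).trans
      ((Finset.sum_le_card_nsmul _ _ 2 fun k _ => ?_).trans ?_))
    · unfold zeroWt
      rw [show (C q ^ 2 * (C (u k) * X) - 1) * (C q * (C (u k) * X - 1)) =
        C (q ^ 3 * u k ^ 2) * X ^ 2 - C (q ^ 3 * u k + q * u k) * X + C q by
          simp only [C_mul, C_pow, C_add]; ring]
      compute_degree
    · simp [mul_comm]
  · rw [Matrix.det_succ_column_zero, eval_finsetSum]
    refine Finset.sum_congr rfl fun i _ => ?_
    rw [eval_mul, eval_C, eval_prod]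
    have h1 : (ikMat' q u x w) i 0 =
        (q ^ 2 - 1) * ∏ k ∈ univ.erase i, zeroWt q (u k * x) := rfl
    have h2 : (ikMat' q u x w).submatrix i.succAbove Fin.succ =
      (ikMat q u w).submatrix i.succAbove id := rfl
    rw [h1, h2]
    have h3 : ∀ k, (zeroWt (C q) (C (u k) * X)).eval x = zeroWt q (u k * x) := by
      intro k
      simp [zeroWt]
    simp only [h3]
    ring

lemma det_ikMat'_of_root {F : Type*} [Field F] (q : F) {n : ℕ} (u : Fin (n + 1) → F) (x : F)
    (w : Fin n → F) (h : zeroWt q (u 0 * x) = 0) :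
    (ikMat' q u x w).det = (q ^ 2 - 1) * (∏ i, zeroWt q (Fin.tail u i * x)) *
      (ikMat q (Fin.tail u) w).det := by
  rw [Matrix.det_succ_column_zero, Fin.sum_univ_succ, Finset.sum_eq_zero, add_zero]
  · have h1 : (ikMat' q u x w).submatrix (Fin.succAbove 0) Fin.succ = ikMat q (Fin.tail u) w := by
      ext i j
      simp [ikMat', ikMat, Fin.tail]
    rw [h1]
    simp only [ikMat', Matrix.of_apply, Fin.cons_zero]
    rw [Fin.univ_succ, Finset.erase_cons, Finset.prod_map]
    simp [Fin.tail]
  · intro i _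
    simp only [ikMat', Matrix.of_apply, Fin.cons_zero]
    rw [Finset.prod_eq_zero (i := (0 : Fin (n + 1))) (by simp [(Fin.succ_ne_zero i).symm]) h]
    simp

lemma inhomZ_eq_det_of_root {F : Type*} [Field F] {q : F} (hq : q ≠ 0) {n : ℕ}
    (u : Fin (n + 1) → F) (w : Fin n → F) (hu : u 0 ≠ 0)
    (ih : inhomZ q (Fin.tail u) w * q ^ (n * n) * (Matrix.vandermonde (Fin.tail u)).det *
      (Matrix.vandermonde w).det =
        q ^ n * (∏ i, ∏ j, zeroWt q (Fin.tail u i * w j)) * (ikMat q (Fin.tail u) w).det) :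
    inhomZ q u (Fin.cons (q ^ 2 * u 0)⁻¹ w) * q ^ ((n + 1) * (n + 1)) *
      (Matrix.vandermonde u).det *
        ((∏ j, (w j - (q ^ 2 * u 0)⁻¹)) * (Matrix.vandermonde w).det) =
      q ^ (n + 1) * (∏ i, ∏ j, zeroWt q (u i * w j)) * (ikMat' q u (q ^ 2 * u 0)⁻¹ w).det := by
  generalize hx : (q ^ 2 * u 0)⁻¹ = x
  have hx0 : q ^ 2 * (u 0 * x) = 1 := by
    rw [← hx, ← mul_assoc]
    exact mul_inv_cancel₀ (mul_ne_zero (pow_ne_zero _ hq) hu)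
  have hV : (Matrix.vandermonde u).det =
      (∏ j, (Fin.tail u j - u 0)) * (Matrix.vandermonde (Fin.tail u)).det := by
    conv_lhs => rw [← Fin.cons_self_tail u]
    exact det_vandermonde_cons _ _
  have h0 : zeroWt q (u 0 * x) = 0 := by simp [zeroWt, hx0]
  have hZ := inhomZ_succ q u (Fin.cons x w) (by simp [hx0])
  simp only [Fin.tail_cons, Fin.cons_zero] at hZ
  have h1 : ∏ j, zeroWt q (u 0 * w j) =
      (q ^ 2 * u 0) ^ n * (∏ j, (w j - x)) * ∏ j, q * (u 0 * w j - 1) := by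
    rw [← Fin.prod_const, ← Finset.prod_mul_distrib, ← Finset.prod_mul_distrib]
    refine Finset.prod_congr rfl fun j _ => ?_
    unfold zeroWt
    linear_combination q * (u 0 * w j - 1) * hx0
  have h2 : (u 0) ^ n * ∏ i, zeroWt q (Fin.tail u i * x) =
      (∏ j, (Fin.tail u j - u 0)) * ∏ i, q * (Fin.tail u i * x - 1) := by
    rw [← Fin.prod_const, ← Finset.prod_mul_distrib, ← Finset.prod_mul_distrib]
    refine Finset.prod_congr rfl fun j _ => ?_
    unfold zeroWt
    linear_combination (Fin.tail u j * q * (Fin.tail u j * x - 1)) * hx0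
  rw [hZ, hV, det_ikMat'_of_root q u x w h0,
    Fin.prod_univ_succ (fun i => ∏ j, zeroWt q (u i * w j)), h1]
  change _ = q ^ (n + 1) * (_ * ∏ i, ∏ j, zeroWt q (Fin.tail u i * w j)) * _
  have e1 : q ^ ((n + 1) * (n + 1)) = q ^ (n * n) * (q ^ 2) ^ n * q := by ring
  rw [e1, mul_pow]
  linear_combination (q ^ 2 - 1) * (∏ j, q * (u 0 * w j - 1)) * (∏ i, q * (Fin.tail u i * x - 1)) *
    (q ^ 2) ^ n * q * (∏ j, (Fin.tail u j - u 0)) * (∏ j, (w j - x)) * ih -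
    q ^ (n + 1) * (q ^ 2) ^ n * (q ^ 2 - 1) * (∏ j, (w j - x)) * (∏ j, q * (u 0 * w j - 1)) *
      (∏ i, ∏ j, zeroWt q (Fin.tail u i * w j)) * (ikMat q (Fin.tail u) w).det * h2

lemma det_vandermonde_comp_perm {R : Type*} [CommRing R] {n : ℕ} (u : Fin n → R)
    (σ : Equiv.Perm (Fin n)) : (Matrix.vandermonde (u ∘ σ)).det =
      (Equiv.Perm.sign σ : ℤ) * (Matrix.vandermonde u).det := by
  rw [← Matrix.det_permute]
  rfl

lemma det_ikMat'_comp_perm {F : Type*} [Field F] (q : F) {n : ℕ} (u : Fin (n + 1) → F) (x : F)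
    (w : Fin n → F) (σ : Equiv.Perm (Fin (n + 1))) : (ikMat' q (u ∘ σ) x w).det =
      (Equiv.Perm.sign σ : ℤ) * (ikMat' q u x w).det := by
  rw [← Matrix.det_permute]
  congr 1
  ext i j
  cases j using Fin.cases with
  | zero =>
    simp only [ikMat', Matrix.of_apply, Fin.cons_zero, Matrix.submatrix_apply, id]
    congr 1
    refine Finset.prod_nbij σ (by simp) σ.injective.injOn ?_ (by simp)
    intro k hk
    exact ⟨σ.symm k, by simpa [Equiv.symm_apply_eq] using hk, by simp⟩
  | succ j => simp [ikMat', ikMat]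

open Polynomial in
theorem inhomZ_eq_det {F : Type*} [Field F] {q : F} (hq : q ≠ 0) {n : ℕ} (u w : Fin n → F)
    (hu0 : ∀ i, u i ≠ 0) (hu : Function.Injective u) (hw : Function.Injective w)
    (hz : ∀ i j, zeroWt q (u i * w j) ≠ 0) (hr : ∀ i j, i ≠ j → q ^ 2 * u j - u i ≠ 0) :
    inhomZ q u w * q ^ (n * n) * (Matrix.vandermonde u).det * (Matrix.vandermonde w).det =
      q ^ n * (∏ i, ∏ j, zeroWt q (u i * w j)) * (ikMat q u w).det := by
  induction n with
  | zero =>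
    rw [inhomZ, Fintype.sum_unique, if_pos]
    · simp only [gridWt, Finset.univ_eq_empty, Finset.prod_empty, Matrix.det_isEmpty, mul_zero,
        pow_zero, mul_one]
    · simp [isASM_iff]
  | succ n ih =>
    obtain ⟨x, w, rfl⟩ : ∃ x w', w = Fin.cons x w' := ⟨w 0, Fin.tail w, (Fin.cons_self_tail w).symm⟩
    obtain ⟨hxw, hw⟩ := Fin.cons_injective_iff.1 hw
    simp only [Fin.forall_fin_succ
        (P := fun j => zeroWt q (_ * (Fin.cons x w : Fin (n + 1) → F) j) ≠ 0),
      Fin.cons_zero, Fin.cons_succ] at hz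
    have hpt : ∀ i, inhomZ q u (Fin.cons (q ^ 2 * u i)⁻¹ w) * q ^ ((n + 1) * (n + 1)) *
        (Matrix.vandermonde u).det *
          ((∏ j, (w j - (q ^ 2 * u i)⁻¹)) * (Matrix.vandermonde w).det) =
        q ^ (n + 1) * (∏ i, ∏ j, zeroWt q (u i * w j)) *
          (ikMat' q u (q ^ 2 * u i)⁻¹ w).det := by
      intro i
      set σ := Equiv.swap 0 i with hσ
      have hσ0 : (u ∘ σ) 0 = u i := by rw [Function.comp_apply, hσ, Equiv.swap_apply_left]
      have h := inhomZ_eq_det_of_root hq (u ∘ σ) w (hu0 _) (ih _ w (fun k => hu0 _)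
        ((hu.comp σ.injective).comp (Fin.succ_injective n)) hw (fun k j => (hz _).2 j)
        fun k l hkl => hr _ _ fun h => hkl (Fin.succ_injective n (σ.injective h)))
      rw [hσ0, inhomZ_comp_perm q u _ hr, det_vandermonde_comp_perm, det_ikMat'_comp_perm,
        show ∏ k, ∏ j, zeroWt q ((u ∘ σ) k * w j) = _ from
          Equiv.prod_comp σ fun i => ∏ j, zeroWt q (u i * w j)] at h
      have hs : ((Equiv.Perm.sign σ : ℤ) : F) ≠ 0 := by
        rcases Int.units_eq_one_or (Equiv.Perm.sign σ) with h | h <;>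
          simp only [h, Units.val_one, Units.val_neg, Int.cast_one, Int.cast_neg, ne_eq, neg_eq_zero,
            one_ne_zero, not_false_eq_true]
      refine mul_left_cancel₀ hs ?_
      linear_combination h
    have hpw : ∀ j, (ikMat' q u (w j) w).det = 0 := by
      intro j
      rw [det_ikMat' q u (w j) w fun i => (hz i).2 j,
        Matrix.det_zero_of_column_eq (Fin.succ_ne_zero j) fun k => by simp [ikMat], mul_zero]
    obtain ⟨p, hp, hpe⟩ := exists_poly_inhomZ q u w
    obtain ⟨r, hr, hre⟩ := exists_poly_ikMat' q u w
    have key : C (q ^ ((n + 1) * (n + 1)) * (Matrix.vandermonde u).det *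
        (Matrix.vandermonde w).det) * p * ∏ j, (C (w j) - X) =
        C (q ^ (n + 1) * ∏ i, ∏ j, zeroWt q (u i * w j)) * r := by
      refine eq_of_natDegree_lt_card_of_eval_eq _ _ (ι := Fin (n + 1) ⊕ Fin n)
        (f := Sum.elim (fun i => (q ^ 2 * u i)⁻¹) w) ?_ ?_ ?_
      · refine Function.Injective.sumElim ?_ hw ?_
        · intro i i' h
          exact hu (mul_left_cancel₀ (pow_ne_zero 2 hq) (inv_injective h))
        · intro i j h
          refine (hz i).2 j ?_
          have h1 : q ^ 2 * u i ≠ 0 := mul_ne_zero (pow_ne_zero 2 hq) (hu0 i)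
          have h2 : q ^ 2 * (u i * w j) = 1 := by rw [← h, ← mul_assoc, mul_inv_cancel₀ h1]
          rw [zeroWt, h2, sub_self, zero_mul]
      · rintro (i | j)
        · simp only [Sum.elim_inl, eval_mul, eval_C, hpe, hre, eval_prod, eval_sub, eval_X]
          linear_combination hpt i
        · simp only [Sum.elim_inr, eval_mul, eval_C, hpe, hre, eval_prod, eval_sub, eval_X]
          rw [hpw, Finset.prod_eq_zero (Finset.mem_univ j) (sub_self _), mul_zero, mul_zero]
      · have h1 : (∏ j, (C (w j) - X)).natDegree ≤ n := by
          refine (natDegree_prod_le _ _).trans ((Finset.sum_le_card_nsmul _ _ 1 fun k _ => ?_).trans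
            (by rw [Finset.card_univ, Fintype.card_fin, smul_eq_mul, mul_one]))
          compute_degree
        have h2 := natDegree_mul_le (p := C (q ^ ((n + 1) * (n + 1)) * (Matrix.vandermonde u).det *
          (Matrix.vandermonde w).det) * p) (q := ∏ j, (C (w j) - X))
        have h3 := natDegree_C_mul_le (q ^ ((n + 1) * (n + 1)) * (Matrix.vandermonde u).det *
          (Matrix.vandermonde w).det) p
        have h4 := natDegree_C_mul_le (q ^ (n + 1) * ∏ i, ∏ j, zeroWt q (u i * w j)) r
        rw [Fintype.card_sum, Fintype.card_fin, Fintype.card_fin, max_lt_iff]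
        omega
    have hx := congrArg (eval x) key
    simp only [eval_mul, eval_C, hpe, hre, eval_prod, eval_sub, eval_X] at hx
    rw [det_ikMat' q u x w fun i => (hz i).1] at hx
    rw [det_vandermonde_cons]
    simp only [Fin.prod_univ_succ (fun j => zeroWt q (_ * (Fin.cons x w : Fin (n + 1) → F) j)),
      Fin.cons_zero, Fin.cons_succ, Finset.prod_mul_distrib]
    linear_combination hx

/-- The equivalence listing `Fin m` before `Fin n`. -/
def sumFinEquiv (m n : ℕ) : Fin m ⊕ Fin n ≃ Fin (n + m) :=
  finSumFinEquiv.trans (finCongr (Nat.add_comm m n))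

lemma cons_sumFinEquiv {γ : Type*} {n : ℕ} (a : γ) (u : Fin n → γ) (i : Fin 1 ⊕ Fin n) :
    (Fin.cons a u : Fin (n + 1) → γ) (sumFinEquiv 1 n i) = Sum.elim ![a] u i := by
  rcases i with i | i
  · have : sumFinEquiv 1 n (Sum.inl i) = 0 := by
      ext
      simp [sumFinEquiv]
    rw [this]
    simp
  · have : sumFinEquiv 1 n (Sum.inr i) = i.succ := by
      ext
      simp [sumFinEquiv]
    rw [this]
    simp

lemma cons_cons_sumFinEquiv {γ : Type*} {n : ℕ} (a b : γ) (u : Fin n → γ) (i : Fin 2 ⊕ Fin n) :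
    (Fin.cons a (Fin.cons b u) : Fin (n + 2) → γ) (sumFinEquiv 2 n i) =
      Sum.elim ![a, b] u i := by
  rcases i with i | i
  · have : sumFinEquiv 2 n (Sum.inl i) = Fin.castLE (by omega) i := by
      ext
      simp [sumFinEquiv]
    rw [this]
    fin_cases i <;> rfl
  · have : sumFinEquiv 2 n (Sum.inr i) = i.succ.succ := by
      ext
      simp only [sumFinEquiv, Equiv.trans_apply, finSumFinEquiv_apply_right, finCongr_apply,
        Fin.val_cast, Fin.val_natAdd, Fin.val_succ]
      omega
    rw [this]
    rfl

/-- The matrix of values of the kernel `f` at the points `u` and `w`. -/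
def kernelMat {F : Type*} (f : F → F → F) {m n : Type*} (u : m → F) (w : n → F) : Matrix m n F :=
  Matrix.of fun i j => f (u i) (w j)

/-- The Schur complement of the kernel `f` with respect to the points `u` and `w`. -/
noncomputable def schurKernel {F : Type*} [Field F] (f : F → F → F) {n : ℕ} (u w : Fin n → F)
    (a c : F) : F :=
  f a c - ∑ l, (∑ k, f a (w k) * (kernelMat f u w)⁻¹ k l) * f (u l) c

lemma det_kernelMat_sumElim {F : Type*} [Field F] (f : F → F → F) {m n : ℕ} (a c : Fin m → F)
    (u w : Fin n → F) (hS : (kernelMat f u w).det ≠ 0) :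
    (kernelMat f (Sum.elim a u) (Sum.elim c w)).det =
      (kernelMat f u w).det * (kernelMat (schurKernel f u w) a c).det := by
  have hu : IsUnit (kernelMat f u w).det := isUnit_iff_ne_zero.2 hS
  let _ := Matrix.invertibleOfIsUnitDet _ hu
  have h1 : kernelMat f (Sum.elim a u) (Sum.elim c w) =
      Matrix.fromBlocks (kernelMat f a c) (kernelMat f a w) (kernelMat f u c)
        (kernelMat f u w) := by
    ext i j
    rcases i with i | i <;> rcases j with j | j <;> rfl
  rw [h1, Matrix.det_fromBlocks₂₂, Matrix.invOf_eq_nonsing_inv]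
  rfl

lemma det_kernelMat_cons {F : Type*} [Field F] (f : F → F → F) {n : ℕ} (a c : F)
    (u w : Fin n → F) (hS : (kernelMat f u w).det ≠ 0) :
    (kernelMat f (Fin.cons a u : Fin (n + 1) → F) (Fin.cons c w : Fin (n + 1) → F)).det =
      (kernelMat f u w).det * schurKernel f u w a c := by
  have h := det_kernelMat_sumElim f ![a] ![c] u w hS
  rw [Matrix.det_fin_one] at h
  change _ = _ * schurKernel f u w a c at h
  rw [← Matrix.det_submatrix_equiv_self (sumFinEquiv 1 n)]
  convert h using 2
  ext i j
  simp only [kernelMat, Matrix.submatrix_apply, Matrix.of_apply, cons_sumFinEquiv]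

lemma det_kernelMat_cons_cons {F : Type*} [Field F] (f : F → F → F) {n : ℕ} (a b c d : F)
    (u w : Fin n → F) (hS : (kernelMat f u w).det ≠ 0) :
    (kernelMat f (Fin.cons a (Fin.cons b u) : Fin (n + 2) → F)
        (Fin.cons c (Fin.cons d w) : Fin (n + 2) → F)).det * (kernelMat f u w).det =
      (kernelMat f (Fin.cons a u : Fin (n + 1) → F) (Fin.cons c w : Fin (n + 1) → F)).det *
        (kernelMat f (Fin.cons b u : Fin (n + 1) → F) (Fin.cons d w : Fin (n + 1) → F)).det -
      (kernelMat f (Fin.cons a u : Fin (n + 1) → F) (Fin.cons d w : Fin (n + 1) → F)).det *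
        (kernelMat f (Fin.cons b u : Fin (n + 1) → F) (Fin.cons c w : Fin (n + 1) → F)).det := by
  have h := det_kernelMat_sumElim f ![a, b] ![c, d] u w hS
  rw [Matrix.det_fin_two] at h
  change _ = _ * (schurKernel f u w a c * schurKernel f u w b d -
    schurKernel f u w a d * schurKernel f u w b c) at h
  have h2 : (kernelMat f (Fin.cons a (Fin.cons b u) : Fin (n + 2) → F)
        (Fin.cons c (Fin.cons d w) : Fin (n + 2) → F)).det =
      (kernelMat f (Sum.elim ![a, b] u) (Sum.elim ![c, d] w)).det := by
    rw [← Matrix.det_submatrix_equiv_self (sumFinEquiv 2 n)]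
    congr 1
    ext i j
    simp only [kernelMat, Matrix.submatrix_apply, Matrix.of_apply, cons_cons_sumFinEquiv]
  rw [h2, h, det_kernelMat_cons f a c u w hS, det_kernelMat_cons f b d u w hS,
    det_kernelMat_cons f a d u w hS, det_kernelMat_cons f b c u w hS]
  ring

lemma inhomZ_bilinear_of_generic {F : Type*} [Field F] {q : F} (hq : q ≠ 0) {n : ℕ}
    (a b c d : F) (u w : Fin n → F)
    (hu0 : ∀ i, (Fin.cons a (Fin.cons b u) : Fin (n + 2) → F) i ≠ 0)
    (hu : Function.Injective (Fin.cons a (Fin.cons b u) : Fin (n + 2) → F))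
    (hw : Function.Injective (Fin.cons c (Fin.cons d w) : Fin (n + 2) → F))
    (hz : ∀ i j, zeroWt q ((Fin.cons a (Fin.cons b u) : Fin (n + 2) → F) i *
      (Fin.cons c (Fin.cons d w) : Fin (n + 2) → F) j) ≠ 0)
    (hr : ∀ i j, i ≠ j → q ^ 2 * (Fin.cons a (Fin.cons b u) : Fin (n + 2) → F) j -
      (Fin.cons a (Fin.cons b u) : Fin (n + 2) → F) i ≠ 0)
    (hZ : inhomZ q u w ≠ 0) :
    q ^ 2 * (a - b) * (c - d) * inhomZ q (Fin.cons a (Fin.cons b u) : Fin (n + 2) → F)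
        (Fin.cons c (Fin.cons d w)) * inhomZ q u w =
      zeroWt q (a * d) * zeroWt q (b * c) *
        inhomZ q (Fin.cons a u : Fin (n + 1) → F) (Fin.cons c w) *
        inhomZ q (Fin.cons b u : Fin (n + 1) → F) (Fin.cons d w) -
      zeroWt q (a * c) * zeroWt q (b * d) *
        inhomZ q (Fin.cons a u : Fin (n + 1) → F) (Fin.cons d w) *
        inhomZ q (Fin.cons b u : Fin (n + 1) → F) (Fin.cons c w) := by
  have hsub : ∀ {m : ℕ} (f g : Fin m → Fin (n + 2)) (hf : Function.Injective f)
      (hg : Function.Injective g),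
      inhomZ q ((Fin.cons a (Fin.cons b u) : Fin (n + 2) → F) ∘ f)
        ((Fin.cons c (Fin.cons d w) : Fin (n + 2) → F) ∘ g) * q ^ (m * m) * _ * _ = _ :=
    fun f g hf hg => inhomZ_eq_det hq _ _ (fun i => hu0 (f i)) (hu.comp hf) (hw.comp hg)
      (fun i j => hz (f i) (g j)) fun i j hij => hr _ _ (hf.ne hij)
  have hA : Function.Injective
      (Fin.cons 0 fun i : Fin n => i.succ.succ : Fin (n + 1) → Fin (n + 2)) := by
    rw [Fin.cons_injective_iff]
    exact ⟨fun ⟨i, hi⟩ => Fin.succ_ne_zero _ hi, (Fin.succ_injective _).comp (Fin.succ_injective _)⟩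
  have cA : ∀ (a b : F) (u : Fin n → F), (Fin.cons a (Fin.cons b u) : Fin (n + 2) → F) ∘
      (Fin.cons 0 fun i : Fin n => i.succ.succ : Fin (n + 1) → Fin (n + 2)) = Fin.cons a u := by
    intro a b u
    funext i
    exact Fin.cases rfl (fun _ => rfl) i
  have cB : ∀ (a b : F) (u : Fin n → F), (Fin.cons a (Fin.cons b u) : Fin (n + 2) → F) ∘
      Fin.succ = Fin.cons b u := fun a b u => rfl
  have cS : ∀ (a b : F) (u : Fin n → F), (Fin.cons a (Fin.cons b u) : Fin (n + 2) → F) ∘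
      (fun i => i.succ.succ) = u := fun a b u => rfl
  have E2 := hsub id id Function.injective_id Function.injective_id
  have E0 := hsub (fun i : Fin n => i.succ.succ) (fun i : Fin n => i.succ.succ)
    ((Fin.succ_injective _).comp (Fin.succ_injective _))
    ((Fin.succ_injective _).comp (Fin.succ_injective _))
  have Eac := hsub _ _ hA hA
  have Ead := hsub _ _ hA (Fin.succ_injective _)
  have Ebc := hsub _ _ (Fin.succ_injective _) hA
  have Ebd := hsub _ _ (Fin.succ_injective (n + 1)) (Fin.succ_injective (n + 1))
  have hVu := (Matrix.det_vandermonde_ne_zero_iff).2 hu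
  have hVw := (Matrix.det_vandermonde_ne_zero_iff).2 hw
  rw [Function.comp_id, Function.comp_id] at E2
  rw [cS, cS] at E0
  rw [cA, cA] at Eac
  rw [cA, cB] at Ead
  rw [cB, cA] at Ebc
  rw [cB, cB] at Ebd
  have hD : (ikMat q u w).det ≠ 0 := by
    intro h0
    rw [h0, mul_zero] at E0
    have h1 : (Matrix.vandermonde u).det ≠ 0 := Matrix.det_vandermonde_ne_zero_iff.2
      (hu.comp ((Fin.succ_injective _).comp (Fin.succ_injective _)))
    have h2 : (Matrix.vandermonde w).det ≠ 0 := Matrix.det_vandermonde_ne_zero_iff.2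
      (hw.comp ((Fin.succ_injective _).comp (Fin.succ_injective _)))
    exact mul_ne_zero (mul_ne_zero (mul_ne_zero hZ (pow_ne_zero _ hq)) h1) h2 E0
  have hDJ := det_kernelMat_cons_cons (fun x y => (q ^ 2 - 1) / zeroWt q (x * y)) a b c d u w hD
  change (ikMat q _ _).det * (ikMat q _ _).det = (ikMat q _ _).det * (ikMat q _ _).det -
    (ikMat q _ _).det * (ikMat q _ _).det at hDJ
  simp only [det_vandermonde_cons, Fin.prod_univ_succ, Fin.cons_zero, Fin.cons_succ,
    Finset.prod_mul_distrib] at E2 E0 Eac Ead Ebc Ebd hVu hVw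
  refine mul_right_cancel₀ (b := q ^ (2 * (n + 1) * (n + 1)) * (∏ j, (u j - a)) * (∏ j, (u j - b)) *
    (∏ j, (w j - c)) * (∏ j, (w j - d)) * (Matrix.vandermonde u).det ^ 2 *
      (Matrix.vandermonde w).det ^ 2) ?_ ?_
  · exact mul_ne_zero (mul_ne_zero (mul_ne_zero (mul_ne_zero (mul_ne_zero (mul_ne_zero
      (pow_ne_zero _ hq) (right_ne_zero_of_mul (left_ne_zero_of_mul hVu)))
      (left_ne_zero_of_mul (right_ne_zero_of_mul hVu)))
      (right_ne_zero_of_mul (left_ne_zero_of_mul hVw)))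
      (left_ne_zero_of_mul (right_ne_zero_of_mul hVw)))
      (pow_ne_zero _ (right_ne_zero_of_mul (right_ne_zero_of_mul hVu))))
      (pow_ne_zero _ (right_ne_zero_of_mul (right_ne_zero_of_mul hVw)))
  · clear hsub hVu hVw hD hu0 hu hw hz hr hZ hA cA cB cS
    generalize inhomZ q (Fin.cons a (Fin.cons b u) : Fin (n + 2) → F)
        (Fin.cons c (Fin.cons d w)) = Z2 at *
    generalize inhomZ q u w = Z0 at *
    generalize inhomZ q (Fin.cons a u : Fin (n + 1) → F) (Fin.cons c w) = Zac at *
    generalize inhomZ q (Fin.cons a u : Fin (n + 1) → F) (Fin.cons d w) = Zad at *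
    generalize inhomZ q (Fin.cons b u : Fin (n + 1) → F) (Fin.cons c w) = Zbc at *
    generalize inhomZ q (Fin.cons b u : Fin (n + 1) → F) (Fin.cons d w) = Zbd at *
    generalize (ikMat q _ _).det = D2, (ikMat q _ _).det = D0, (ikMat q _ _).det = Dac,
      (ikMat q _ _).det = Dad, (ikMat q _ _).det = Dbc, (ikMat q _ _).det = Dbd at *
    generalize zeroWt q (a * c) = zac, zeroWt q (a * d) = zad, zeroWt q (b * c) = zbc,
      zeroWt q (b * d) = zbd at *
    generalize (∏ j, zeroWt q (a * w j)) = Ra, (∏ j, zeroWt q (b * w j)) = Rb,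
      (∏ i, zeroWt q (u i * c)) = Lc, (∏ i, zeroWt q (u i * d)) = Ld,
      (∏ i, ∏ j, zeroWt q (u i * w j)) = P at *
    generalize (∏ j, (u j - a)) = Aa, (∏ j, (u j - b)) = Ab, (∏ j, (w j - c)) = Cc,
      (∏ j, (w j - d)) = Cd, (Matrix.vandermonde u).det = Vu,
      (Matrix.vandermonde w).det = Vw at *
    have m1 := congrArg₂ (· * ·) E2 E0
    have m2 := congrArg₂ (· * ·) Eac Ebd
    have m3 := congrArg₂ (· * ·) Ead Ebc
    beta_reduce at m1 m2 m3
    linear_combination m1 - zad * zbc * m2 + zac * zbd * m3 +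
      q ^ (2 * n + 2) * zac * zad * zbc * zbd * Ra * Rb * Lc * Ld * P ^ 2 * hDJ

/-- The difference of the two sides of the bilinear identity relating the partition functions
obtained by deleting rows and columns. -/
noncomputable def bilinearDefect {R : Type*} [CommRing R] {n : ℕ} (q a b c d : R)
    (u w : Fin n → R) : R :=
  q ^ 2 * (a - b) * (c - d) * inhomZ q (Fin.cons a (Fin.cons b u) : Fin (n + 2) → R)
      (Fin.cons c (Fin.cons d w)) * inhomZ q u w -
    (zeroWt q (a * d) * zeroWt q (b * c) *
        inhomZ q (Fin.cons a u : Fin (n + 1) → R) (Fin.cons c w) *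
        inhomZ q (Fin.cons b u : Fin (n + 1) → R) (Fin.cons d w) -
      zeroWt q (a * c) * zeroWt q (b * d) *
        inhomZ q (Fin.cons a u : Fin (n + 1) → R) (Fin.cons d w) *
        inhomZ q (Fin.cons b u : Fin (n + 1) → R) (Fin.cons c w))

lemma map_bilinearDefect {R S : Type*} [CommRing R] [CommRing S] (f : R →+* S) {n : ℕ}
    (q a b c d : R) (u w : Fin n → R) :
    f (bilinearDefect q a b c d u w) =
      bilinearDefect (f q) (f a) (f b) (f c) (f d) (f ∘ u) (f ∘ w) := by
  simp only [bilinearDefect, zeroWt, map_sub, map_mul, map_pow, map_one, map_inhomZ,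
    Fin.comp_cons]

lemma bilinearDefect_eq_zero_of_generic {F : Type*} [Field F] {q : F} (hq : q ≠ 0) {n : ℕ}
    (U W : Fin (n + 2) → F) (hU0 : ∀ i, U i ≠ 0) (hU : Function.Injective U)
    (hW : Function.Injective W) (hz : ∀ i j, zeroWt q (U i * W j) ≠ 0)
    (hr : ∀ i j, i ≠ j → q ^ 2 * U j - U i ≠ 0)
    (hZ : inhomZ q (fun i : Fin n => U i.succ.succ) (fun i => W i.succ.succ) ≠ 0) :
    bilinearDefect q (U 0) (U 1) (W 0) (W 1) (fun i : Fin n => U i.succ.succ)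
      (fun i => W i.succ.succ) = 0 := by
  have hcons : ∀ V : Fin (n + 2) → F,
      (Fin.cons (V 0) (Fin.cons (V 1) fun i => V i.succ.succ) : Fin (n + 2) → F) = V := by
    intro V
    funext i
    exact Fin.cases rfl (fun i => Fin.cases rfl (fun i => rfl) i) i
  rw [bilinearDefect, sub_eq_zero]
  apply inhomZ_bilinear_of_generic hq
  · rwa [hcons]
  · rwa [hcons]
  · rwa [hcons]
  · rwa [hcons, hcons]
  · rwa [hcons]
  · exact hZ

lemma bilinearDefect_eq_zero_of_domain {R K : Type*} [CommRing R] [IsDomain R] [Field K]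
    (ev : R →+* K) {q : R} (hq : q ≠ 0) {n : ℕ}
    (U W : Fin (n + 2) → R) (hU0 : ∀ i, U i ≠ 0) (hU : Function.Injective U)
    (hW : Function.Injective W) (hz : ∀ i j, zeroWt q (U i * W j) ≠ 0)
    (hr : ∀ i j, i ≠ j → q ^ 2 * U j - U i ≠ 0)
    (hZ : inhomZ (ev q) (fun i : Fin n => ev (U i.succ.succ)) (fun i => ev (W i.succ.succ)) ≠ 0) :
    bilinearDefect (ev q) (ev (U 0)) (ev (U 1)) (ev (W 0)) (ev (W 1))
      (fun i : Fin n => ev (U i.succ.succ)) (fun i => ev (W i.succ.succ)) = 0 := by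
  have hι : Function.Injective (algebraMap R (FractionRing R)) := IsFractionRing.injective R _
  generalize algebraMap R (FractionRing R) = ι at hι
  have hι0 : ∀ {r}, r ≠ 0 → ι r ≠ 0 := fun h => (map_ne_zero_iff ι hι).2 h
  have key : bilinearDefect q (U 0) (U 1) (W 0) (W 1)
      (fun i : Fin n => U i.succ.succ) (fun i => W i.succ.succ) = 0 := by
    apply hι
    rw [map_bilinearDefect, map_zero]
    refine bilinearDefect_eq_zero_of_generic (hι0 hq) (ι ∘ U) (ι ∘ W) (fun i => hι0 (hU0 i))
      (hι.comp hU) (hι.comp hW) (fun i j => ?_) (fun i j hij => ?_) ?_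
    · have := hι0 (hz i j)
      rwa [zeroWt, map_mul, map_mul, map_sub, map_sub, map_mul, map_mul, map_pow, map_one] at this
    · have := hι0 (hr i j hij)
      rwa [map_sub, map_mul, map_pow] at this
    · have : inhomZ q (fun i : Fin n => U i.succ.succ) (fun i => W i.succ.succ) ≠ 0 := by
        intro h
        apply hZ
        have h2 := congrArg ev h
        rw [map_inhomZ, map_zero] at h2
        exact h2
      have := hι0 this
      rwa [map_inhomZ] at this
  have h := congrArg ev key
  rw [map_bilinearDefect, map_zero] at h
  exact h

lemma bilinearDefect_eq_zero {K : Type*} [Field K] {q : K} (hq : q ≠ 0) {n : ℕ}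
    (a b c d : K) (u w : Fin n → K) (hZ : inhomZ q u w ≠ 0) :
    bilinearDefect q a b c d u w = 0 := by
  let u₂ : Fin (n + 2) → K := Fin.cons a (Fin.cons b u)
  let w₂ : Fin (n + 2) → K := Fin.cons c (Fin.cons d w)
  have h := bilinearDefect_eq_zero_of_domain
    (MvPolynomial.eval (Sum.elim u₂ w₂) : MvPolynomial (Fin (n + 2) ⊕ Fin (n + 2)) K →+* K)
    (q := MvPolynomial.C q) ((MvPolynomial.C_ne_zero).2 hq) (fun i => MvPolynomial.X (Sum.inl i))
    (fun j => MvPolynomial.X (Sum.inr j)) (fun i => MvPolynomial.X_ne_zero _)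
    (fun i j h => Sum.inl_injective (MvPolynomial.X_injective h))
    (fun i j h => Sum.inr_injective (MvPolynomial.X_injective h)) ?_ ?_
  · simp only [MvPolynomial.eval_C, MvPolynomial.eval_X] at h
    exact h hZ
  · intro i j h
    have h2 := congrArg (MvPolynomial.eval (0 : Fin (n + 2) ⊕ Fin (n + 2) → K)) h
    simp only [zeroWt, MvPolynomial.eval_mul, MvPolynomial.eval_sub, MvPolynomial.eval_C,
      MvPolynomial.eval_X, MvPolynomial.eval_pow, map_one, Pi.zero_apply, mul_zero, zero_sub,
      map_zero] at h2
    apply hq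
    linear_combination h2
  · intro i j hij h
    have h2 := congrArg (MvPolynomial.eval
      (Pi.single (Sum.inl i) 1 : Fin (n + 2) ⊕ Fin (n + 2) → K)) h
    have hne : (Sum.inl j : Fin (n + 2) ⊕ Fin (n + 2)) ≠ Sum.inl i :=
      fun h => hij (Sum.inl_injective h).symm
    simp only [MvPolynomial.eval_mul, MvPolynomial.eval_sub, MvPolynomial.eval_C,
      MvPolynomial.eval_X, MvPolynomial.eval_pow, Pi.single_eq_same, Pi.single_eq_of_ne hne,
      mul_zero, zero_sub, map_zero] at h2
    exact neg_ne_zero.2 one_ne_zero h2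

lemma sum_psum_of_sum_eq_one {n : ℕ} {A : Fin n → Fin n → ℤ} (h : ∀ j, ∑ i, A i j = 1) :
    2 * ∑ i, ∑ j, psum (A i) j = n * (n - 1) := by
  have h1 : ∀ j : Fin n, ∑ i, psum (A i) j = (j : ℕ) := by
    intro j
    simp only [psum]
    rw [Finset.sum_comm]
    have : ∀ j', ∑ i, (if j' < j then A i j' else 0) = if j' < j then (1 : ℤ) else 0 := by
      intro j'
      split_ifs
      · exact h j'
      · simp
    rw [Finset.sum_congr rfl fun j' _ => this j', ← Finset.sum_filter, Finset.sum_const,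
      Finset.filter_gt_eq_Iio, Fin.card_Iio]
    simp
  rw [Finset.sum_comm, Finset.sum_congr rfl fun j _ => h1 j,
    Fin.sum_univ_eq_sum_range (fun j => (j : ℤ)) n, ← Nat.cast_sum, mul_comm 2]
  have := Finset.sum_range_id_mul_two n
  zify at this
  rw [Nat.cast_sum, this]
  cases n <;> simp

lemma IsASM.sum_entries {n : ℕ} {A : Fin n → Fin n → ℤ} (hA : IsASM A) :
    ∑ i, ∑ j, A i j = n := by
  rw [isASM_iff] at hA
  simp [hA.2.2.2.1]

lemma IsASM.sum_gauge {n : ℕ} {A : Fin n → Fin n → ℤ} (hA : IsASM A) :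
    ∑ i, ∑ j, (1 - psum (A i) j - psum (fun i' => A i' j) i - A i j) = 0 := by
  have h1 := sum_psum_of_sum_eq_one (isASM_iff.1 hA).2.2.2.2
  have h2 := sum_psum_of_sum_eq_one (isASM_iff.1 hA.transpose).2.2.2.2
  have h3 := hA.sum_entries
  rw [Finset.sum_comm] at h2
  simp only [Finset.sum_sub_distrib, h3]
  simp only [Finset.sum_const, Finset.card_univ, Fintype.card_fin, nsmul_eq_mul, mul_one]
  linarith

lemma IsASM.entry_cases {n : ℕ} {A : Fin n → Fin n → ℤ} (hA : IsASM A) (i j : Fin n) :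
    (A i j = 0 ∧ psum (A i) j = 0 ∧ psum (fun i' => A i' j) i = 0) ∨
    (A i j = 0 ∧ psum (A i) j = 1 ∧ psum (fun i' => A i' j) i = 1) ∨
    (A i j = 0 ∧ psum (A i) j = 0 ∧ psum (fun i' => A i' j) i = 1) ∨
    (A i j = 0 ∧ psum (A i) j = 1 ∧ psum (fun i' => A i' j) i = 0) ∨
    (A i j = 1 ∧ psum (A i) j = 0 ∧ psum (fun i' => A i' j) i = 0) ∨
    (A i j = -1 ∧ psum (A i) j = 1 ∧ psum (fun i' => A i' j) i = 1) := by
  rw [isASM_iff] at hA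
  have h1 := psum_mem (hA.2.1 i) j
  have h2 := psum_mem (f := fun i' => A i' j) (fun i => hA.2.2.1 i j) i
  have h3 := hA.2.1 i j
  have h4 := hA.2.2.1 i j
  rcases h1 with h1 | h1 <;> rcases h2 with h2 | h2 <;> rcases hA.1 i j with h5 | h5 | h5 <;>
    simp [h1, h2, h5] at h3 h4 ⊢

lemma IsASM.nuASM_eq {n : ℕ} {A : Fin n → Fin n → ℤ} (hA : IsASM A) :
    (nuASM A : ℤ) = ∑ i, ∑ j, psum (fun i' => A i' j) i * (psum (A i) j + A i j) := by
  have h : (∑ i : Fin n, ∑ i' : Fin n, ∑ j : Fin n, ∑ j' : Fin n,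
      if i < i' ∧ j' ≤ j then A i j * A i' j' else 0) =
      ∑ i, ∑ j, psum (fun i' => A i' j) i * (psum (A i) j + A i j) := by
    rw [Finset.sum_comm]
    refine Finset.sum_congr rfl fun i' _ => ?_
    rw [Finset.sum_comm]
    refine Finset.sum_congr rfl fun j _ => ?_
    rw [← sum_filter_le, Finset.sum_filter, psum, Finset.sum_mul_sum]
    refine Finset.sum_congr rfl fun i _ => Finset.sum_congr rfl fun j' _ => ?_
    by_cases h1 : i < i' <;> by_cases h2 : j' ≤ j <;> simp [h1, h2]
  rw [nuASM, h, Int.toNat_of_nonneg]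
  refine Finset.sum_nonneg fun i _ => Finset.sum_nonneg fun j _ => ?_
  rcases hA.entry_cases i j with h | h | h | h | h | h <;> simp [h]

lemma muASM_eq {n : ℕ} (A : Fin n → Fin n → ℤ) :
    (muASM A : ℤ) = ∑ i, ∑ j, if A i j = -1 then 1 else 0 := by
  rw [muASM, ← Finset.sum_product', Finset.card_filter]
  push_cast
  rfl

lemma prod_zpow_eq_zpow_sum {K ι : Type*} [Field K] {c : K} (hc : c ≠ 0) (S : Finset ι)
    (f : ι → ℤ) : ∏ i ∈ S, c ^ f i = c ^ ∑ i ∈ S, f i := by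
  classical
  induction S using Finset.induction_on with
  | empty => simp
  | insert a S ha ih => rw [Finset.prod_insert ha, Finset.sum_insert ha, zpow_add₀ hc, ih]

/-- Parameters for which the homogeneous six-vertex weights have the ratios prescribed by the
statistics `x` (inversions) and `y` (entries equal to `-1`). -/
structure IsHomParam {K : Type*} [Field K] (q s k t x y : K) : Prop where
  s_ne : s ≠ 0
  k_ne : k ≠ 0
  y_ne : y ≠ 0
  hα : q ^ 2 * t - 1 = s * (q * (t - 1))
  hk : k * (q * (t - 1)) = q ^ 2 - 1
  hx : x = s ^ 2
  hy : y = k ^ 2 * t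

lemma gridWt_const {K : Type*} [Field K] {q s k c d x y : K}
    (h : IsHomParam q s k (c * d) x y) {n : ℕ}
    {A : Fin n → Fin n → ℤ} (hA : IsASM A) :
    gridWt q (fun _ => c) (fun _ => d) (fun _ => 0) A =
      (q * (c * d - 1)) ^ (n * n) * k ^ n * (x ^ nuASM A * y ^ muASM A) := by
  obtain ⟨hs, hk, hy0, hα, hkβ, hx, hy⟩ := h
  have hx0 : x ≠ 0 := by simp [hx, hs]
  have hv : ∀ i j, vertexWt q (c * d) (psum (A i) j) (0 + psum (fun i' => A i' j) i) (A i j) =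
      q * (c * d - 1) * s ^ (1 - psum (A i) j - psum (fun i' => A i' j) i - A i j) *
        k ^ A i j * x ^ (psum (fun i' => A i' j) i * (psum (A i) j + A i j)) *
        y ^ (if A i j = -1 then (1 : ℤ) else 0) := by
    intro i j
    rcases hA.entry_cases i j with ⟨h1, h2, h3⟩ | ⟨h1, h2, h3⟩ | ⟨h1, h2, h3⟩ | ⟨h1, h2, h3⟩ |
      ⟨h1, h2, h3⟩ | ⟨h1, h2, h3⟩ <;> rw [h1, h2, h3] <;> simp [vertexWt]
    · rw [hα]
      ring
    · rw [hα, hx]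
      field_simp
    · rw [← hkβ]
      ring
    · rw [← hkβ, hy]
      field_simp
  unfold gridWt
  simp only [hv, Finset.prod_mul_distrib, prod_zpow_eq_zpow_sum hs, prod_zpow_eq_zpow_sum hk,
    prod_zpow_eq_zpow_sum hx0, prod_zpow_eq_zpow_sum hy0, ← hA.nuASM_eq, hA.sum_gauge,
    hA.sum_entries, ← muASM_eq, Finset.prod_const, Finset.card_univ, Fintype.card_fin, zpow_zero,
    zpow_natCast]
  rw [mul_pow q]
  ring

lemma zun_eq {R : Type*} [CommRing R] (n : ℕ) (x y : R) : Zun n x y =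
    ∑ e : Fin n → Fin n → Fin 3, open Classical in
      if IsASM (asmMat e) then x ^ nuASM (asmMat e) * y ^ muASM (asmMat e) else 0 := by
  simp [Zun, Zqua]

lemma zsing_eq {R : Type*} [CommRing R] (n : ℕ) (x y z : R) : Zsing n x y z =
    ∑ e : Fin n → Fin n → Fin 3, open Classical in
      if IsASM (asmMat e) then
        x ^ nuASM (asmMat e) * y ^ muASM (asmMat e) * z ^ rhoT (asmMat e) else 0 := by
  simp [Zsing, Zqua]

lemma inhomZ_const {K : Type*} [Field K] {q s k c d x y : K}
    (h : IsHomParam q s k (c * d) x y) (n : ℕ) :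
    inhomZ q (fun _ : Fin n => c) (fun _ => d) =
      (q * (c * d - 1)) ^ (n * n) * k ^ n * Zun n x y := by
  rw [inhomZ, zun_eq, Finset.mul_sum]
  refine Finset.sum_congr rfl fun e _ => ?_
  split_ifs with hA
  · exact gridWt_const h hA
  · simp

lemma psum_single {n : ℕ} (p j : Fin n) :
    psum (Pi.single p 1) j = if p < j then 1 else 0 := by
  simp only [psum, Pi.single_apply]
  rw [Finset.sum_eq_single p] <;> simp +contextual

lemma rhoT_eq {n : ℕ} {A : Fin (n + 1) → Fin (n + 1) → ℤ} {p : Fin (n + 1)}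
    (h : A 0 = Pi.single p 1) : rhoT A = p := by
  have : ∀ j : Fin (n + 1), (A ⟨0, j.pos⟩ j = 0 ∧ ∃ j', j < j' ∧ A ⟨0, j.pos⟩ j' = 1) ↔ j < p := by
    intro j
    change (A 0 j = 0 ∧ ∃ j', j < j' ∧ A 0 j' = 1) ↔ j < p
    rw [h]
    constructor
    · rintro ⟨-, j', hj, h1⟩
      by_cases hp : j' = p
      · exact hp ▸ hj
      · simp [hp] at h1
    · intro hj
      exact ⟨by simp [hj.ne], p, hj, by simp⟩
  rw [rhoT, Finset.filter_congr fun j _ => this j, Finset.filter_gt_eq_Iio, Fin.card_Iio]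

lemma rhoL_eq {n : ℕ} {A : Fin (n + 1) → Fin (n + 1) → ℤ} {p : Fin (n + 1)}
    (h : (fun i => A i 0) = Pi.single p 1) : rhoL A = p :=
  rhoT_eq (A := fun i j => A j i) h

lemma prod_vertexWt_single {K : Type*} [Field K] {q t t' ρ z : K}
    (h1 : q ^ 2 * t' - 1 = ρ * z * (q ^ 2 * t - 1)) (h2 : q * (t' - 1) = ρ * (q * (t - 1)))
    {n : ℕ} (p : Fin (n + 1)) :
    ∏ j, vertexWt q t' (psum (Pi.single p 1) j) 0 ((Pi.single p 1 : Fin (n + 1) → ℤ) j) =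
      ρ ^ n * z ^ (p : ℕ) *
        ∏ j, vertexWt q t (psum (Pi.single p 1) j) 0 ((Pi.single p 1 : Fin (n + 1) → ℤ) j) := by
  have h : ∀ j, vertexWt q t' (psum (Pi.single p 1) j) 0 ((Pi.single p 1 : Fin (n + 1) → ℤ) j) =
      (if j = p then 1 else ρ) * (if j < p then z else 1) *
        vertexWt q t (psum (Pi.single p 1) j) 0 ((Pi.single p 1 : Fin (n + 1) → ℤ) j) := by
    intro j
    rw [psum_single]
    rcases lt_trichotomy j p with hj | hj | hj
    · simp [vertexWt, hj, hj.ne, hj.not_gt, h1]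
    · simp [vertexWt, hj]
    · simp [vertexWt, hj, hj.ne', hj.not_gt, h2]
  rw [Finset.prod_congr rfl fun j _ => h j, Finset.prod_mul_distrib, Finset.prod_mul_distrib]
  congr 2
  · rw [← Finset.mul_prod_erase _ _ (Finset.mem_univ p), if_pos rfl, one_mul,
      Finset.prod_congr rfl fun j hj => if_neg (Finset.ne_of_mem_erase hj)]
    simp
  · rw [← Finset.prod_filter, Finset.filter_gt_eq_Iio, Finset.prod_const, Fin.card_Iio]

lemma gridWt_cons_row {K : Type*} [Field K] {q c d r ρ z : K}
    (h1 : q ^ 2 * (r * d) - 1 = ρ * z * (q ^ 2 * (c * d) - 1))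
    (h2 : q * (r * d - 1) = ρ * (q * (c * d - 1))) {n : ℕ}
    {A : Fin (n + 1) → Fin (n + 1) → ℤ} (hA : IsASM A) :
    gridWt q (Fin.cons r fun _ => c) (fun _ => d) (fun _ => 0) A =
      ρ ^ n * z ^ rhoT A * gridWt q (fun _ => c) (fun _ => d) (fun _ => 0) A := by
  obtain ⟨p, hp⟩ := hA.exists_row
  rw [rhoT_eq hp]
  simp only [gridWt]
  rw [Fin.prod_univ_succ, Fin.prod_univ_succ (n := n) (f := fun i => ∏ j, vertexWt _ (c * d) _ _ _)]
  simp only [Fin.cons_zero, Fin.cons_succ, psum_zero, add_zero, hp]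
  rw [prod_vertexWt_single h1 h2, mul_assoc]

lemma inhomZ_cons_row {K : Type*} [Field K] {q s k c d x y r ρ z : K}
    (h : IsHomParam q s k (c * d) x y)
    (h1 : q ^ 2 * (r * d) - 1 = ρ * z * (q ^ 2 * (c * d) - 1))
    (h2 : q * (r * d - 1) = ρ * (q * (c * d - 1))) (n : ℕ) :
    inhomZ q (Fin.cons r fun _ : Fin n => c : Fin (n + 1) → K) (fun _ => d) =
      (q * (c * d - 1)) ^ ((n + 1) * (n + 1)) * k ^ (n + 1) * ρ ^ n * Zsing (n + 1) x y z := by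
  rw [inhomZ, zsing_eq, Finset.mul_sum]
  refine Finset.sum_congr rfl fun e _ => ?_
  split_ifs with hA
  · rw [gridWt_cons_row h1 h2 hA, gridWt_const h hA]
    ring
  · simp

lemma inhomZ_cons_col {K : Type*} [Field K] {q s k c d x y r ρ z : K}
    (h : IsHomParam q s k (c * d) x y)
    (h1 : q ^ 2 * (c * r) - 1 = ρ * z * (q ^ 2 * (c * d) - 1))
    (h2 : q * (c * r - 1) = ρ * (q * (c * d - 1))) (n : ℕ) :
    inhomZ q (fun _ => c) (Fin.cons r fun _ : Fin n => d : Fin (n + 1) → K) =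
      (q * (c * d - 1)) ^ ((n + 1) * (n + 1)) * k ^ (n + 1) * ρ ^ n * Zsing (n + 1) x y z := by
  rw [mul_comm c] at h h1 h2 ⊢
  rw [mul_comm c] at h1 h2
  rw [inhomZ_comm, inhomZ_cons_row h h1 h2]

lemma gridWt_cons_cons {K : Type*} [Field K] {q c d r w ρ₁ ρ₂ z₁ z₂ : K}
    (hα : q ^ 2 * (c * d) - 1 ≠ 0) (hz₁ : z₁ ≠ 0) (hz₂ : z₂ ≠ 0)
    (h1 : q ^ 2 * (r * d) - 1 = ρ₁ * z₁ * (q ^ 2 * (c * d) - 1))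
    (h2 : q * (r * d - 1) = ρ₁ * (q * (c * d - 1)))
    (h3 : q ^ 2 * (c * w) - 1 = ρ₂ * z₂ * (q ^ 2 * (c * d) - 1))
    (h4 : q * (c * w - 1) = ρ₂ * (q * (c * d - 1))) {n : ℕ}
    {A : Fin (n + 1) → Fin (n + 1) → ℤ} (hA : IsASM A) (hA0 : A 0 0 = 0) :
    gridWt q (Fin.cons r fun _ => c) (Fin.cons w fun _ => d) (fun _ => 0) A *
        (ρ₁ * ρ₂ * (q ^ 2 * (c * d) - 1)) =
      (q ^ 2 * (r * w) - 1) * (ρ₁ * ρ₂) ^ n * z₁ ^ (rhoT A - 1) * z₂ ^ (rhoL A - 1) *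
        gridWt q (fun _ => c) (fun _ => d) (fun _ => 0) A := by
  obtain ⟨p, hp⟩ := hA.exists_row
  obtain ⟨p', hp'⟩ := hA.exists_col
  have hp0 : (p : ℕ) ≠ 0 := by
    intro h0
    have : p = 0 := Fin.ext h0
    rw [hp, this] at hA0
    simp at hA0
  have hp0' : (p' : ℕ) ≠ 0 := by
    intro h0
    have : p' = 0 := Fin.ext h0
    have h5 := congrFun hp' 0
    rw [this] at h5
    simp [hA0] at h5
  rw [rhoT_eq hp, rhoL_eq hp']
  have hrow := prod_vertexWt_single h1 h2 p
  have hcol := prod_vertexWt_single h3 h4 p'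
  rw [← hp, Fin.prod_univ_succ, Fin.prod_univ_succ (n := n)] at hrow
  rw [← hp', Fin.prod_univ_succ, Fin.prod_univ_succ (n := n)] at hcol
  have hcol' : ∀ i : Fin n, vertexWt q (c * w) 0 (psum (fun i' => A i' 0) i.succ) (A i.succ 0) =
    vertexWt q (c * w) (psum (fun i' => A i' 0) i.succ) 0 (A i.succ 0) :=
    fun i => vertexWt_comm ..
  have hcol'' : ∀ i : Fin n, vertexWt q (c * d) 0 (psum (fun i' => A i' 0) i.succ) (A i.succ 0) =
    vertexWt q (c * d) (psum (fun i' => A i' 0) i.succ) 0 (A i.succ 0) :=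
    fun i => vertexWt_comm ..
  simp only [psum_zero, hA0, vertexWt_zero_zero_zero, h1, h3] at hrow hcol
  simp only [gridWt]
  rw [Fin.prod_univ_succ, Fin.prod_univ_succ (n := n) (f := fun i => ∏ j, vertexWt _ (c * d) _ _ _)]
  simp only [Fin.prod_univ_succ (n := n) (f := fun j => vertexWt _ _ _ _ _), Fin.cons_zero,
    Fin.cons_succ, psum_zero, add_zero, zero_add, hA0, vertexWt_zero_zero_zero,
    Finset.prod_mul_distrib, hcol', hcol'']
  generalize ∏ j : Fin n, vertexWt q (r * d) _ _ _ = R' at *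
  generalize ∏ j : Fin n, vertexWt q (c * d) _ 0 (A 0 j.succ) = R at *
  generalize ∏ j : Fin n, vertexWt q (c * w) _ _ _ = C' at *
  generalize ∏ i : Fin n, vertexWt q (c * d) _ 0 (A i.succ 0) = C at *
  generalize ∏ i : Fin n, ∏ j : Fin n, vertexWt q (c * d) _ _ _ = B
  obtain ⟨m, hm⟩ := Nat.exists_eq_succ_of_ne_zero hp0
  obtain ⟨m', hm'⟩ := Nat.exists_eq_succ_of_ne_zero hp0'
  rw [hm] at hrow ⊢
  rw [hm'] at hcol ⊢
  generalize q ^ 2 * (c * d) - 1 = α at *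
  rw [Nat.succ_eq_add_one] at hrow hcol
  have e1 : ρ₁ * R' = ρ₁ ^ n * z₁ ^ m * R :=
    mul_left_cancel₀ (mul_ne_zero hz₁ hα) (by linear_combination hrow)
  have e2 : ρ₂ * C' = ρ₂ ^ n * z₂ ^ m' * C :=
    mul_left_cancel₀ (mul_ne_zero hz₂ hα) (by linear_combination hcol)
  simp only [Nat.succ_eq_add_one, Nat.add_sub_cancel]
  rw [mul_pow]
  linear_combination (q ^ 2 * (r * w) - 1) * α * B * (ρ₂ * C' * e1 + ρ₁ ^ n * z₁ ^ m * R * e2)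

open Classical in
/-- The doubly-refined generating function of alternating sign matrices of size `n + 1` with a
zero in the top left corner; the exponents are the distances, minus one, from that corner to the
`1` of the top row and to the `1` of the left-most column. -/
noncomputable def cornerZ {R : Type*} [CommRing R] (n : ℕ) (x y z₁ z₂ : R) : R :=
  ∑ e : Fin (n + 1) → Fin (n + 1) → Fin 3,
    if IsASM (asmMat e) ∧ asmMat e 0 0 = 0 then
      x ^ nuASM (asmMat e) * y ^ muASM (asmMat e) * z₁ ^ (rhoT (asmMat e) - 1) *
        z₂ ^ (rhoL (asmMat e) - 1)
    else 0

lemma inhomZ_cons_cons {K : Type*} [Field K] {q s k c d x y r w ρ₁ ρ₂ z₁ z₂ : K}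
    (h : IsHomParam q s k (c * d) x y) (hα : q ^ 2 * (c * d) - 1 ≠ 0) (hz₁ : z₁ ≠ 0) (hz₂ : z₂ ≠ 0)
    (h1 : q ^ 2 * (r * d) - 1 = ρ₁ * z₁ * (q ^ 2 * (c * d) - 1))
    (h2 : q * (r * d - 1) = ρ₁ * (q * (c * d - 1)))
    (h3 : q ^ 2 * (c * w) - 1 = ρ₂ * z₂ * (q ^ 2 * (c * d) - 1))
    (h4 : q * (c * w - 1) = ρ₂ * (q * (c * d - 1))) (n : ℕ) :
    inhomZ q (Fin.cons r fun _ : Fin n => c : Fin (n + 1) → K) (Fin.cons w fun _ => d) *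
        (ρ₁ * ρ₂ * (q ^ 2 * (c * d) - 1)) =
      (q * (c * d - 1)) ^ ((n + 1) * (n + 1)) * k ^ (n + 1) * (ρ₁ * ρ₂) ^ n *
        (ρ₁ * ρ₂ * (q ^ 2 * (c * d) - 1) * Zun n x y +
          (q ^ 2 * (r * w) - 1) * cornerZ n x y z₁ z₂) := by
  rw [inhomZ, sum_isASM_succ, add_mul, mul_add]
  congr 1
  · rw [zun_eq, Finset.sum_mul, Finset.mul_sum, Finset.mul_sum]
    refine Finset.sum_congr rfl fun e _ => ?_
    split_ifs with hA
    · rw [gridWt_cornerMat]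
      simp only [Fin.cons_zero, Fin.tail_cons]
      rw [gridWt_const h hA, h2, h4, ← h.hk]
      simp only [Finset.prod_const, Finset.card_univ, Fintype.card_fin]
      rw [mul_pow ρ₁, mul_pow ρ₂]
      generalize q * (c * d - 1) = β
      ring
    · simp
  · rw [cornerZ, Finset.sum_mul, Finset.mul_sum, Finset.mul_sum]
    refine Finset.sum_congr rfl fun e _ => ?_
    split_ifs with hA
    · rw [gridWt_cons_cons hα hz₁ hz₂ h1 h2 h3 h4 hA.1 hA.2, gridWt_const h hA.1]
      generalize (q * (c * d - 1)) ^ ((n + 1) * (n + 1)) = P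
      ring
    · simp

lemma cons_const {α : Type*} (n : ℕ) (a : α) :
    (Fin.cons a fun _ : Fin n => a : Fin (n + 1) → α) = fun _ => a := by
  funext i
  cases i using Fin.cases <;> rfl

lemma bilinear_cancel {K : Type*} [Field K] {a₀ a₁ a₂ p₁ p₂ α β α₁ β₁ E ρ₁ ρ₂ z₁ z₂ D₁ D₂ Y₁ Y₂
    Z₀ Z₁ S₁ S₂ : K} (ha₁ : a₁ ≠ 0) (hp₁ : p₁ ≠ 0) (hp₂ : p₂ ≠ 0) (hρ₁ : ρ₁ ≠ 0) (hρ₂ : ρ₂ ≠ 0)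
    (hβ : β ≠ 0) (ha : a₀ * a₂ = a₁ ^ 2 * β ^ 2)
    (hD₁ : D₁ * (ρ₁ * ρ₂ * α) = a₁ * (p₁ * p₂) * Y₁)
    (hD₂ : D₂ * (ρ₁ * ρ₂ * α) = a₂ * (p₁ * p₂ * (ρ₁ * ρ₂)) * Y₂)
    (hB : E * D₂ * (a₀ * Z₀) =
      ρ₁ * z₁ * α * (ρ₁ * β) * (ρ₂ * z₂ * α * (ρ₂ * β)) * D₁ * (a₁ * Z₁) -
        α₁ * β₁ * (α * β) * (a₁ * p₁ * S₁) * (a₁ * p₂ * S₂)) :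
    β * E * Y₂ * Z₀ = β * (ρ₁ * ρ₂ * z₁ * z₂ * α ^ 2) * Y₁ * Z₁ - α₁ * β₁ * α ^ 2 * S₁ * S₂ := by
  have hc : a₁ ^ 2 * (p₁ * p₂) * (ρ₁ * ρ₂) * β ≠ 0 := mul_ne_zero (mul_ne_zero (mul_ne_zero
    (pow_ne_zero _ ha₁) (mul_ne_zero hp₁ hp₂)) (mul_ne_zero hρ₁ hρ₂)) hβ
  refine mul_left_cancel₀ hc ?_
  linear_combination (ρ₁ * ρ₂ * α) * hB - E * (a₀ * Z₀) * hD₂ +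
    (ρ₁ * z₁ * α * (ρ₁ * β)) * (ρ₂ * z₂ * α * (ρ₂ * β)) * (a₁ * Z₁) * hD₁ -
    p₁ * p₂ * (ρ₁ * ρ₂) * E * Y₂ * Z₀ * ha

lemma bilinear_rescale {K : Type*} [Field K] {α β α₁ β₁ E P x y z₁ z₂ X₁ X₂ Z₀ Z₁ S₁ S₂ : K}
    (hα : α ≠ 0) (hβ : β ≠ 0) (hP : P ≠ 0) (hα₁ : α₁ ≠ 0)
    (h5 : E * y = P * α ^ 2 * ((z₁ - 1) * (z₂ - 1)))
    (h6 : α₁ * y = -(P * α * ((z₁ - 1) * (z₂ - 1) - y * z₁ * z₂)))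
    (h7 : β₁ * y = -(P * β * (x * ((z₁ - 1) * (z₂ - 1)) - y)))
    (G : β * E * (P * α * Z₁ + α₁ * X₂) * Z₀ =
      β * (P * z₁ * z₂ * α ^ 2) * (P * α * Z₀ + α₁ * X₁) * Z₁ - α₁ * β₁ * α ^ 2 * S₁ * S₂) :
    (z₁ - 1) * (z₂ - 1) * X₂ * Z₀ =
      y * z₁ * z₂ * X₁ * Z₁ + y * Z₁ * Z₀ + (x * ((z₁ - 1) * (z₂ - 1)) - y) * S₁ * S₂ := by
  have G2 : (z₁ - 1) * (z₂ - 1) * (P * α * Z₁ + α₁ * X₂) * Z₀ =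
      y * z₁ * z₂ * (P * α * Z₀ + α₁ * X₁) * Z₁ +
        α₁ * (x * ((z₁ - 1) * (z₂ - 1)) - y) * S₁ * S₂ := by
    refine mul_left_cancel₀ (a := β * P * α ^ 2) (mul_ne_zero (mul_ne_zero hβ hP)
      (pow_ne_zero _ hα)) ?_
    linear_combination y * G - β * (P * α * Z₁ + α₁ * X₂) * Z₀ * h5 - α₁ * α ^ 2 * S₁ * S₂ * h7
  refine mul_left_cancel₀ hα₁ ?_
  linear_combination G2 - Z₁ * Z₀ * h6

lemma cornerZ_recursion_of_params {K : Type*} [Field K] {q s k t x y r w ρ₁ ρ₂ z₁ z₂ : K}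
    (h : IsHomParam q s k t x y) (hq : q ≠ 0) (hβ : q * (t - 1) ≠ 0)
    (hz₁ : z₁ ≠ 0) (hz₂ : z₂ ≠ 0) (hρ₁ : ρ₁ ≠ 0) (hρ₂ : ρ₂ ≠ 0)
    (h1 : q ^ 2 * (r * t) - 1 = ρ₁ * z₁ * (q ^ 2 * t - 1))
    (h2 : q * (r * t - 1) = ρ₁ * (q * (t - 1)))
    (h3 : q ^ 2 * w - 1 = ρ₂ * z₂ * (q ^ 2 * t - 1))
    (h4 : q * (w - 1) = ρ₂ * (q * (t - 1)))
    (h5 : q ^ 2 * (r - 1) * (w - t) * y =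
      ρ₁ * ρ₂ * (q ^ 2 * t - 1) ^ 2 * ((z₁ - 1) * (z₂ - 1)))
    (h6 : (q ^ 2 * (r * w) - 1) * y =
      -(ρ₁ * ρ₂ * (q ^ 2 * t - 1) * ((z₁ - 1) * (z₂ - 1) - y * z₁ * z₂)))
    (h7 : q * (r * w - 1) * y =
      -(ρ₁ * ρ₂ * (q * (t - 1)) * (x * ((z₁ - 1) * (z₂ - 1)) - y)))
    (hγ : (z₁ - 1) * (z₂ - 1) - y * z₁ * z₂ ≠ 0) {n : ℕ} (hZ : Zun n x y ≠ 0) :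
    (z₁ - 1) * (z₂ - 1) * cornerZ (n + 1) x y z₁ z₂ * Zun n x y =
      y * z₁ * z₂ * cornerZ n x y z₁ z₂ * Zun (n + 1) x y + y * Zun (n + 1) x y * Zun n x y +
        (x * ((z₁ - 1) * (z₂ - 1)) - y) * Zsing (n + 1) x y z₁ * Zsing (n + 1) x y z₂ := by
  have hα : q ^ 2 * t - 1 ≠ 0 := by
    rw [h.hα]
    exact mul_ne_zero h.s_ne hβ
  have h11 : q ^ 2 * (r * w) - 1 ≠ 0 := by
    intro h0
    rw [h0, zero_mul, eq_comm, neg_eq_zero] at h6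
    exact mul_ne_zero (mul_ne_zero (mul_ne_zero hρ₁ hρ₂) hα) hγ h6
  rw [← one_mul t] at h
  have e0 := inhomZ_const h n
  have e1 := inhomZ_const h (n + 1)
  have g1 : q ^ 2 * (r * t) - 1 = ρ₁ * z₁ * (q ^ 2 * (1 * t) - 1) := by rw [one_mul, h1]
  have g2 : q * (r * t - 1) = ρ₁ * (q * (1 * t - 1)) := by rw [one_mul, h2]
  have g3 : q ^ 2 * (1 * w) - 1 = ρ₂ * z₂ * (q ^ 2 * (1 * t) - 1) := by
    rw [one_mul, one_mul, h3]
  have g4 : q * (1 * w - 1) = ρ₂ * (q * (1 * t - 1)) := by rw [one_mul, one_mul, h4]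
  have hD := inhomZ_cons_cons h (by rwa [one_mul]) hz₁ hz₂ g1 g2 g3 g4
  have eD1 := hD n
  have eD2 := hD (n + 1)
  have eR := inhomZ_cons_row h g1 g2 n
  have eC := inhomZ_cons_col h g3 g4 n
  have hZ0 : inhomZ q (fun _ : Fin n => 1) (fun _ => t) ≠ 0 := by
    rw [e0, one_mul]
    exact mul_ne_zero (mul_ne_zero (pow_ne_zero _ hβ) (pow_ne_zero _ h.k_ne)) hZ
  have B := bilinearDefect_eq_zero hq r 1 w t (fun _ : Fin n => 1) (fun _ => t) hZ0
  simp only [bilinearDefect, sub_eq_zero, cons_const, zeroWt] at B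
  rw [e0, e1, eR, eC] at B
  rw [g1, g2, g3, g4] at B
  simp only [one_mul] at B eD1 eD2
  refine bilinear_rescale hα hβ (mul_ne_zero hρ₁ hρ₂) h11 h5 h6 h7 ?_
  refine bilinear_cancel
    (a₂ := (q * (t - 1)) ^ ((n + 1 + 1) * (n + 1 + 1)) * k ^ (n + 1 + 1))
    (mul_ne_zero (pow_ne_zero _ hβ) (pow_ne_zero _ h.k_ne)) (pow_ne_zero n hρ₁)
    (pow_ne_zero n hρ₂) hρ₁ hρ₂ hβ ?_ ?_ ?_ B
  · generalize q * (t - 1) = β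
    ring
  · rw [eD1, mul_pow ρ₁]
  · rw [eD2, pow_succ (ρ₁ * ρ₂), mul_pow ρ₁]

lemma cornerZ_recursion {K : Type*} [Field K] {q s x y z₁ z₂ : K} (hq : q ≠ 0) (hs : s ≠ 0)
    (hq1 : q ^ 2 - 1 ≠ 0) (hx : x = s ^ 2) (hy : y * q = (1 - s * q) * (q - s)) (hy0 : y ≠ 0)
    (hz₁ : z₁ ≠ 0) (hz₂ : z₂ ≠ 0) (hqz₁ : q - z₁ * s ≠ 0) (hqz₂ : q - z₂ * s ≠ 0)
    (hγ : (z₁ - 1) * (z₂ - 1) - y * z₁ * z₂ ≠ 0) {n : ℕ} (hZ : Zun n x y ≠ 0) :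
    (z₁ - 1) * (z₂ - 1) * cornerZ (n + 1) x y z₁ z₂ * Zun n x y =
      y * z₁ * z₂ * cornerZ n x y z₁ z₂ * Zun (n + 1) x y + y * Zun (n + 1) x y * Zun n x y +
        (x * ((z₁ - 1) * (z₂ - 1)) - y) * Zsing (n + 1) x y z₁ * Zsing (n + 1) x y z₂ := by
  have h0 := mul_ne_zero hy0 hq
  rw [hy] at h0
  have ha : 1 - s * q ≠ 0 := left_ne_zero_of_mul h0
  have hb : q - s ≠ 0 := right_ne_zero_of_mul h0
  have hy' : y = (1 - s * q) * (q - s) / q := by rw [← hy, mul_div_cancel_right₀ _ hq]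
  obtain ⟨t, ht⟩ : ∃ t, t = (1 - s * q) / (q * (q - s)) := ⟨_, rfl⟩
  have hβ : q * (t - 1) = (1 - q ^ 2) / (q - s) := by
    rw [ht]
    field_simp
    ring
  have hα : q ^ 2 * t - 1 = s * (1 - q ^ 2) / (q - s) := by
    rw [ht]
    field_simp
    ring
  have hq1' : 1 - q ^ 2 ≠ 0 := by rwa [← neg_ne_zero, neg_sub]
  have hβi : ∀ z, q - z * s ≠ 0 → q * ((1 - z * s * q) / (q * (q - z * s)) - 1) =
      (q - s) / (q - z * s) * (q * (t - 1)) := by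
    intro z hz
    rw [hβ]
    field_simp
    ring
  have hαi : ∀ z, q - z * s ≠ 0 → q ^ 2 * ((1 - z * s * q) / (q * (q - z * s))) - 1 =
      (q - s) / (q - z * s) * z * (q ^ 2 * t - 1) := by
    intro z hz
    rw [hα]
    field_simp
    ring
  have hr : (1 - z₁ * s * q) / (q * (q - z₁ * s)) / t * t =
      (1 - z₁ * s * q) / (q * (q - z₁ * s)) :=
    div_mul_cancel₀ _ (by rw [ht]; exact div_ne_zero ha (mul_ne_zero hq hb))
  refine cornerZ_recursion_of_params (k := s - q) (s := s) (t := t) (q := q)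
    (r := (1 - z₁ * s * q) / (q * (q - z₁ * s)) / t) (w := (1 - z₂ * s * q) / (q * (q - z₂ * s)))
    ⟨hs, ?_, hy0, ?_, ?_, hx, ?_⟩ hq ?_ hz₁ hz₂ (div_ne_zero hb hqz₁) (div_ne_zero hb hqz₂)
    (by rw [hr, hαi _ hqz₁]) (by rw [hr, hβi _ hqz₁]) (hαi _ hqz₂) (hβi _ hqz₂) ?_ ?_ ?_ hγ hZ
  · rwa [← neg_ne_zero, neg_sub]
  · rw [hα, hβ]
    ring
  · rw [hβ]
    field_simp
    ring
  · rw [hy', ht]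
    field_simp
    ring
  · rw [hβ]
    exact div_ne_zero hq1' hb
  all_goals
    clear hγ hZ hr hβi hαi
    rw [hy', ht]
    first | rw [← ht, hα, ht] | rw [← ht, hβ, ht]
    try rw [hx]
    obtain ⟨a, ha'⟩ : ∃ a, a = 1 - s * q := ⟨_, rfl⟩
    obtain ⟨b, hb'⟩ : ∃ b, b = q - s := ⟨_, rfl⟩
    obtain ⟨c₁, hc₁⟩ : ∃ c, c = q - z₁ * s := ⟨_, rfl⟩
    obtain ⟨c₂, hc₂⟩ : ∃ c, c = q - z₂ * s := ⟨_, rfl⟩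
    rw [← ha'] at ha
    rw [← hb'] at hb
    rw [← hc₁] at hqz₁
    rw [← hc₂] at hqz₂
    rw [← ha', ← hb', ← hc₁, ← hc₂]
    field_simp
    rw [ha', hb', hc₁, hc₂]
    ring

lemma Zqua_map {R S : Type*} [CommRing R] [CommRing S] (f : R →+* S) (n : ℕ)
    (x y z₁ z₂ z₃ z₄ : R) :
    Zqua n (f x) (f y) (f z₁) (f z₂) (f z₃) (f z₄) = f (Zqua n x y z₁ z₂ z₃ z₄) := by
  simp only [Zqua, map_sum, apply_ite f, map_mul, map_pow, map_zero]

lemma Zun_map {R S : Type*} [CommRing R] [CommRing S] (f : R →+* S) (n : ℕ) (x y : R) :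
    Zun n (f x) (f y) = f (Zun n x y) := by
  simp only [Zun, ← Zqua_map, map_one]

lemma Zsing_map {R S : Type*} [CommRing R] [CommRing S] (f : R →+* S) (n : ℕ) (x y z : R) :
    Zsing n (f x) (f y) (f z) = f (Zsing n x y z) := by
  simp only [Zsing, ← Zqua_map, map_one]

lemma Zcoeff_map {R S : Type*} [CommRing R] [CommRing S] (f : R →+* S) (n k : ℕ) (x y : R) :
    Zcoeff n k (f x) (f y) = f (Zcoeff n k x y) := by
  simp only [Zcoeff, map_sum, apply_ite f, map_mul, map_pow, map_zero]

lemma cornerZ_map {R S : Type*} [CommRing R] [CommRing S] (f : R →+* S) (n : ℕ)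
    (x y z₁ z₂ : R) :
    cornerZ n (f x) (f y) (f z₁) (f z₂) = f (cornerZ n x y z₁ z₂) := by
  simp only [cornerZ, map_sum, apply_ite f, map_mul, map_pow, map_zero]

lemma cornerZ_recursion_map {K R : Type*} [Field K] [CommRing R] [IsDomain R] (ψ : K →+* R)
    {q s x y : K} {z₁ z₂ : R} (hq : q ≠ 0) (hs : s ≠ 0) (hq1 : q ^ 2 - 1 ≠ 0) (hx : x = s ^ 2)
    (hy : y * q = (1 - s * q) * (q - s)) (hy0 : y ≠ 0) (hz₁ : z₁ ≠ 0) (hz₂ : z₂ ≠ 0)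
    (hqz₁ : ψ q - z₁ * ψ s ≠ 0) (hqz₂ : ψ q - z₂ * ψ s ≠ 0)
    (hγ : (z₁ - 1) * (z₂ - 1) - ψ y * z₁ * z₂ ≠ 0) {n : ℕ} (hZ : Zun n x y ≠ 0) :
    (z₁ - 1) * (z₂ - 1) * cornerZ (n + 1) (ψ x) (ψ y) z₁ z₂ * ψ (Zun n x y) =
      ψ y * z₁ * z₂ * cornerZ n (ψ x) (ψ y) z₁ z₂ * ψ (Zun (n + 1) x y) +
        ψ y * ψ (Zun (n + 1) x y) * ψ (Zun n x y) +
        (ψ x * ((z₁ - 1) * (z₂ - 1)) - ψ y) * Zsing (n + 1) (ψ x) (ψ y) z₁ *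
          Zsing (n + 1) (ψ x) (ψ y) z₂ := by
  obtain ⟨F, hF, φ, hφ⟩ : ∃ (F : Type _) (_ : Field F) (φ : R →+* F), Function.Injective φ :=
    ⟨FractionRing R, inferInstance, algebraMap R (FractionRing R),
      IsFractionRing.injective R (FractionRing R)⟩
  have ne {a : R} (h : a ≠ 0) : φ a ≠ 0 := (map_ne_zero_iff φ hφ).2 h
  have ne' {a : K} (h : a ≠ 0) : φ (ψ a) ≠ 0 := ne ((map_ne_zero_iff ψ ψ.injective).2 h)
  apply hφ
  simp only [map_mul, map_add, map_sub, map_one, ← Zun_map, ← Zsing_map, ← cornerZ_map]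
  refine cornerZ_recursion (ne' hq) (ne' hs) ?_ ?_ ?_ (ne' hy0) (ne hz₁) (ne hz₂) ?_ ?_ ?_ ?_
  · simpa only [map_sub, map_pow, map_one] using ne' hq1
  · rw [hx, map_pow, map_pow]
  · simpa only [map_sub, map_mul, map_one] using congrArg (fun a => φ (ψ a)) hy
  · simpa only [map_sub, map_mul] using ne hqz₁
  · simpa only [map_sub, map_mul] using ne hqz₂
  · simpa only [map_sub, map_mul, map_one] using ne hγ
  · simpa only [Zun_map] using ne' hZ

lemma nuASM_cornerMat {n : ℕ} {A : Fin n → Fin n → ℤ} (hA : IsASM A) :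
    nuASM (cornerMat 0 1 A) = nuASM A := by
  zify
  rw [hA.nuASM_eq, (isASM_cornerMat.2 hA).nuASM_eq]
  simp [Fin.sum_univ_succ, cornerMat, Fin.tail_def]

lemma muASM_cornerMat {n : ℕ} (A : Fin n → Fin n → ℤ) :
    muASM (cornerMat 0 1 A) = muASM A := by
  zify
  rw [muASM_eq, muASM_eq]
  simp [Fin.sum_univ_succ, cornerMat]

lemma cornerZ_one_one {R : Type*} [CommRing R] (n : ℕ) (x y : R) :
    Zun (n + 1) x y = Zun n x y + cornerZ n x y 1 1 := by
  classical
  have h := sum_isASM_succ (n := n) fun A => x ^ nuASM A * y ^ muASM A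
  simp only [zun_eq, cornerZ, one_pow, mul_one]
  convert h using 2
  refine Finset.sum_congr rfl fun e _ => ?_
  split_ifs with hA
  · rw [nuASM_cornerMat hA, muASM_cornerMat]
  · rfl

lemma rhoT_le {n : ℕ} (A : Fin (n + 1) → Fin (n + 1) → ℤ) : rhoT A ≤ n := by
  refine Nat.lt_succ_iff.1 ((Finset.card_lt_univ_of_notMem (x := Fin.last n) ?_).trans_eq
    (Fintype.card_fin _))
  simp only [Finset.mem_filter, not_and, not_exists]
  intro _ _ j hj
  exact absurd hj (Fin.le_last j).not_gt

lemma rhoL_le {n : ℕ} (A : Fin (n + 1) → Fin (n + 1) → ℤ) : rhoL A ≤ n := by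
  refine Nat.lt_succ_iff.1 ((Finset.card_lt_univ_of_notMem (x := Fin.last n) ?_).trans_eq
    (Fintype.card_fin _))
  simp only [Finset.mem_filter, not_and, not_exists]
  intro _ _ j hj
  exact absurd hj (Fin.le_last j).not_gt

open PowerSeries in
lemma coeff_mul_zsing {K : Type*} [Field K] (x y : K) (n m : ℕ) (f : K⟦X⟧) :
    coeff m (f * Zsing n (C x) (C y) X) =
      ∑ j ∈ range (m + 1), coeff (m - j) f * Zcoeff n j x y := by
  have h (j : ℕ) : coeff j (Zsing n (C x) (C y) X) = Zcoeff n j x y := by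
    rw [zsing_eq, map_sum]
    refine Finset.sum_congr rfl fun e _ => ?_
    rw [← map_pow, ← map_pow, ← map_mul]
    by_cases hA : IsASM (asmMat e)
    · rw [if_pos hA, coeff_C_mul, coeff_X_pow, mul_ite, mul_one, mul_zero]
      simp only [hA, true_and, eq_comm]
    · simp only [hA, false_and, if_false, map_zero]
  rw [mul_comm, coeff_mul, Finset.Nat.sum_antidiagonal_eq_sum_range_succ_mk]
  exact Finset.sum_congr rfl fun j _ => by rw [h, mul_comm]

open PowerSeries

/-- A commutative ring with the features of the ring of formal power series in two variables that
are needed for the extraction of the diagonal coefficients. -/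
structure DiagonalCoeff (K R : Type*) [Field K] [CommRing R] where
  /-- the inclusion of the power series in the first variable -/
  fst : K⟦X⟧ →+* R
  /-- the inclusion of the power series in the second variable -/
  snd : K⟦X⟧ →+* R
  /-- the diagonal coefficients -/
  diag : ℕ → R →+ K
  snd_C : ∀ a, snd (C a) = fst (C a)
  diag_C_mul : ∀ m a f, diag m (fst (C a) * f) = a * diag m f
  diag_fst_mul_snd : ∀ m f g, diag m (fst f * snd g) = coeff m f * coeff m g
  diag_zero_X_mul : ∀ f, diag 0 (fst X * (snd X * f)) = 0
  diag_succ_X_mul : ∀ m f, diag (m + 1) (fst X * (snd X * f)) = diag m f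

noncomputable def diagonalCoeffPowerSeries (K : Type*) [Field K] : DiagonalCoeff K K⟦X⟧⟦X⟧ where
  fst := C
  snd := PowerSeries.map C
  diag m := (coeff m : K⟦X⟧ →ₗ[K] K).toAddMonoidHom.comp
    (coeff m : K⟦X⟧⟦X⟧ →ₗ[K⟦X⟧] K⟦X⟧).toAddMonoidHom
  snd_C _ := map_C _ _
  diag_C_mul m a f := by
    change coeff m (coeff m (C (C a) * f)) = _
    rw [coeff_C_mul, coeff_C_mul]
    rfl
  diag_fst_mul_snd m f g := by
    change coeff m (coeff m (C f * PowerSeries.map C g)) = _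
    rw [coeff_C_mul, coeff_map, coeff_mul_C]
  diag_zero_X_mul f := by
    change coeff 0 (coeff 0 (C X * (PowerSeries.map C X * f))) = _
    rw [map_X, coeff_C_mul, coeff_zero_X_mul]
  diag_succ_X_mul m f := by
    change coeff (m + 1) (coeff (m + 1) (C X * (PowerSeries.map C X * f))) = _
    rw [map_X, coeff_C_mul, coeff_succ_X_mul, coeff_succ_X_mul]
    rfl

lemma mul_sub_one_cancel {R : Type*} [CommRing R] {A B g₁ g₂ z₁ z₂ x y E E' c c' S T : R}
    (h₁ : g₁ * (1 - z₁) = 1) (h₂ : g₂ * (1 - z₂) = 1)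
    (h : (z₁ - 1) * (z₂ - 1) * E' * c = y * z₁ * z₂ * E * c' + y * c' * c +
      (x * ((z₁ - 1) * (z₂ - 1)) - y) * S * T) :
    c * (A * B * E') = y * (c' * (z₁ * (z₂ * ((A * g₁) * (B * g₂) * E)))) +
      y * (c' * (c * ((A * g₁) * (B * g₂)))) + x * ((A * S) * (B * T)) -
        y * ((A * g₁ * S) * (B * g₂ * T)) := by
  linear_combination (A * g₁ * B * g₂) * h -
    (A * B * (c * E' - x * S * T)) * (g₂ * (1 - z₂)) * h₁ - (A * B * (c * E' - x * S * T)) * h₂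

namespace DiagonalCoeff

variable {K R : Type*} [Field K] [CommRing R] (D : DiagonalCoeff K R)

/-- Multiplication by this series sums the coefficients `i` times in each of the two variables. -/
noncomputable def sumPow (i : ℕ) : R :=
  D.fst ((PowerSeries.mk 1) ^ i) * D.snd ((PowerSeries.mk 1) ^ i)

lemma diag_recursion_step {x y c c' : K} {E E' : R} {S : K⟦X⟧}
    (h : (D.fst X - 1) * (D.snd X - 1) * E' * D.fst (C c) =
      D.fst (C y) * D.fst X * D.snd X * E * D.fst (C c') +
      D.fst (C y) * D.fst (C c') * D.fst (C c) +
        (D.fst (C x) * ((D.fst X - 1) * (D.snd X - 1)) - D.fst (C y)) * D.fst S * D.snd S)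
    (m i : ℕ) :
    c * D.diag m (D.sumPow i * E') =
      y * (c' * D.diag m (D.fst X * (D.snd X * (D.sumPow (i + 1) * E)))) +
        y * (c' * (c * (coeff m ((PowerSeries.mk 1 : K⟦X⟧) ^ (i + 1))) ^ 2)) +
        x * (coeff m ((PowerSeries.mk 1) ^ i * S)) ^ 2 -
        y * (coeff m ((PowerSeries.mk 1) ^ (i + 1) * S)) ^ 2 := by
  have h0 := mk_one_mul_one_sub_eq_one K
  have key := mul_sub_one_cancel (A := D.fst ((PowerSeries.mk 1) ^ i))
    (B := D.snd ((PowerSeries.mk 1) ^ i)) (g₁ := D.fst (PowerSeries.mk 1))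
    (g₂ := D.snd (PowerSeries.mk 1))
    (by rw [← map_one D.fst, ← map_sub, ← map_mul, h0])
    (by rw [← map_one D.snd, ← map_sub, ← map_mul, h0]) h
  rw [← map_mul, ← map_mul, ← pow_succ, ← map_mul, ← map_mul, ← map_mul, ← map_mul] at key
  have := congrArg (D.diag m) key
  rw [map_sub, map_add, map_add] at this
  simp only [D.diag_C_mul, D.diag_fst_mul_snd] at this
  simp only [sumPow, this, pow_two]

end DiagonalCoeff

/-- The terms of the solution of the recursion satisfied by the corner generating functions. -/
noncomputable def recursionTerm {K : Type*} [Field K] (x y : K) (c : ℕ → K) (S : ℕ → K⟦X⟧)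
    (m i k : ℕ) : K :=
  y ^ (k + 1) * (coeff m ((PowerSeries.mk 1 : K⟦X⟧) ^ (i + 1))) ^ 2 +
    (x * y ^ k * (coeff m ((PowerSeries.mk 1) ^ i * S m)) ^ 2 -
      y ^ (k + 1) * (coeff m ((PowerSeries.mk 1) ^ (i + 1) * S m)) ^ 2) / (c (m + 1) * c m)

lemma recursionTerm_succ {K : Type*} [Field K] (x y : K) (c : ℕ → K) (S : ℕ → K⟦X⟧)
    (m i k : ℕ) : recursionTerm x y c S m i (k + 1) = y * recursionTerm x y c S m i k := by
  simp only [recursionTerm]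
  ring

lemma recursionTerm_zero {K : Type*} [Field K] (x y : K) {c : ℕ → K} (hc : ∀ n, c n ≠ 0)
    (S : ℕ → K⟦X⟧) (m i : ℕ) : c m * (c (m + 1) * recursionTerm x y c S m i 0) =
      y * (c (m + 1) * (c m * (coeff m ((PowerSeries.mk 1 : K⟦X⟧) ^ (i + 1))) ^ 2)) +
        x * (coeff m ((PowerSeries.mk 1) ^ i * S m)) ^ 2 -
        y * (coeff m ((PowerSeries.mk 1) ^ (i + 1) * S m)) ^ 2 := by
  have h1 := hc m
  have h2 := hc (m + 1)
  simp only [recursionTerm]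
  generalize c m = c₀ at *
  generalize c (m + 1) = c₁ at *
  field_simp
  ring

lemma DiagonalCoeff.diag_recursion {K R : Type*} [Field K] [CommRing R] (D : DiagonalCoeff K R)
    {x y : K} {c : ℕ → K} {E : ℕ → R} {S : ℕ → K⟦X⟧} (hc : ∀ n, c n ≠ 0)
    (h : ∀ n, (D.fst X - 1) * (D.snd X - 1) * E (n + 1) * D.fst (C (c n)) =
      D.fst (C y) * D.fst X * D.snd X * E n * D.fst (C (c (n + 1))) +
      D.fst (C y) * D.fst (C (c (n + 1))) * D.fst (C (c n)) +
        (D.fst (C x) * ((D.fst X - 1) * (D.snd X - 1)) - D.fst (C y)) * D.fst (S n) *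
          D.snd (S n))
    (N i : ℕ) :
    D.diag N (D.sumPow i * E (N + 1)) =
      c (N + 1) * ∑ k ∈ range (N + 1), recursionTerm x y c S (N - k) (i + k) k := by
  induction N generalizing i with
  | zero =>
    have step := D.diag_recursion_step (h 0) 0 i
    rw [D.diag_zero_X_mul, mul_zero, mul_zero, zero_add] at step
    rw [Finset.sum_range_one, Nat.sub_zero, add_zero]
    refine mul_left_cancel₀ (hc 0) ?_
    rw [step, recursionTerm_zero x y hc, zero_add]
  | succ N ih =>
    have step := D.diag_recursion_step (h (N + 1)) (N + 1) i
    rw [D.diag_succ_X_mul, ih (i + 1)] at step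
    have e (k : ℕ) : recursionTerm x y c S (N + 1 - (k + 1)) (i + (k + 1)) (k + 1) =
        y * recursionTerm x y c S (N - k) (i + 1 + k) k := by
      rw [recursionTerm_succ, Nat.add_sub_add_right, add_right_comm, add_assoc]
    rw [Finset.sum_range_succ', Finset.sum_congr rfl fun k _ => e k, ← Finset.mul_sum,
      Nat.sub_zero, add_zero]
    refine mul_left_cancel₀ (hc (N + 1)) ?_
    have hT := recursionTerm_zero x y hc S (N + 1) i
    rw [step, mul_add, mul_add, hT]
    ring

lemma DiagonalCoeff.diag_sumPow_mul_cornerZ {K R : Type*} [Field K] [CommRing R]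
    (D : DiagonalCoeff K R) (N : ℕ) (x y : K) :
    D.diag N (D.sumPow 1 *
      cornerZ (N + 1) (D.fst (C x)) (D.fst (C y)) (D.fst X) (D.snd X)) =
      cornerZ (N + 1) x y 1 1 := by
  have hcoeff {a : ℕ} (ha : a ≤ N) : coeff N ((PowerSeries.mk 1 : K⟦X⟧) ^ 1 * X ^ a) = 1 := by
    rw [coeff_mul_X_pow', if_pos ha, pow_one, coeff_mk, Pi.one_apply]
  rw [cornerZ, cornerZ, Finset.mul_sum, map_sum]
  refine Finset.sum_congr rfl fun e _ => ?_
  split_ifs with h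
  · have hT := hcoeff (Nat.sub_le_of_le_add (rhoT_le (asmMat e)))
    have hL := hcoeff (Nat.sub_le_of_le_add (rhoL_le (asmMat e)))
    generalize rhoT (asmMat e) - 1 = a at *
    generalize rhoL (asmMat e) - 1 = b at *
    have e1 : D.sumPow 1 * (D.fst (C x) ^ nuASM (asmMat e) * D.fst (C y) ^ muASM (asmMat e) *
        D.fst X ^ a * D.snd X ^ b) = D.fst (C (x ^ nuASM (asmMat e) * y ^ muASM (asmMat e))) *
        (D.fst ((PowerSeries.mk 1) ^ 1 * X ^ a) * D.snd ((PowerSeries.mk 1) ^ 1 * X ^ b)) := by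
      simp only [DiagonalCoeff.sumPow, map_mul, map_pow]
      ring
    rw [e1, D.diag_C_mul, D.diag_fst_mul_snd, hT, hL]
    simp only [one_pow, mul_one]
  · rw [mul_zero, map_zero]

lemma DiagonalCoeff.zun_recursion {K R : Type*} [Field K] [CommRing R] [IsDomain R]
    (D : DiagonalCoeff K R) {q s x y : K} (hq : q ≠ 0) (hs : s ≠ 0) (hq1 : q ^ 2 - 1 ≠ 0)
    (hx : x = s ^ 2) (hy : y * q = (1 - s * q) * (q - s)) (hy0 : y ≠ 0)
    (hZ : ∀ n, Zun n x y ≠ 0) (N : ℕ) :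
    Zun (N + 2) x y = Zun (N + 1) x y * (1 + ∑ k ∈ range (N + 1),
      recursionTerm x y (fun n => Zun n x y) (fun n => Zsing (n + 1) (C x) (C y) X)
        (N - k) (1 + k) k) := by
  have ne {m : ℕ} {f : R} (h : D.diag m f ≠ 0) : f ≠ 0 := fun h0 => h (by rw [h0, map_zero])
  have hX : D.fst X * D.snd X ≠ 0 := ne (m := 1) (by
    rw [D.diag_fst_mul_snd, coeff_one_X, mul_one]
    exact one_ne_zero)
  have hqs : coeff 0 (C q - X * C s) ≠ 0 := by
    rw [map_sub, coeff_zero_X_mul, sub_zero, coeff_zero_C]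
    exact hq
  have h1 : coeff 0 (1 : K⟦X⟧) = 1 := coeff_zero_one
  have hX1 : coeff 0 (X - 1 : K⟦X⟧) = -1 := by
    rw [map_sub, coeff_zero_X, h1, zero_sub]
  have h (n : ℕ) := cornerZ_recursion_map (n := n) (D.fst.comp C) hq hs hq1 hx hy hy0
    (left_ne_zero_of_mul hX) (right_ne_zero_of_mul hX) (ne (m := 0) (by
      change D.diag 0 (D.fst (C q) - D.fst X * D.fst (C s)) ≠ 0
      rw [← map_mul, ← map_sub, ← mul_one (D.fst _), ← map_one D.snd, D.diag_fst_mul_snd, h1,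
        mul_one]
      exact hqs)) (ne (m := 0) (by
      change D.diag 0 (D.fst (C q) - D.snd X * D.fst (C s)) ≠ 0
      rw [← D.snd_C, ← D.snd_C, ← map_mul, ← map_sub, ← one_mul (D.snd _), ← map_one D.fst,
        D.diag_fst_mul_snd, h1, one_mul]
      exact hqs)) (ne (m := 0) (by
      change D.diag 0 ((D.fst X - 1) * (D.snd X - 1) - D.fst (C y) * D.fst X * D.snd X) ≠ 0
      rw [mul_comm (D.fst (C y)), mul_assoc, mul_comm (D.fst (C y)), map_sub, D.diag_zero_X_mul,
        ← map_one D.fst, ← map_sub, map_one D.fst, ← map_one D.snd, ← map_sub,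
        D.diag_fst_mul_snd, hX1]
      norm_num)) (hZ n)
  have hS (n : ℕ) : Zsing n (D.fst (C x)) (D.fst (C y)) (D.snd X) =
      D.snd (Zsing n (C x) (C y) X) := by
    rw [← D.snd_C, ← D.snd_C, Zsing_map]
  simp only [RingHom.comp_apply, hS, Zsing_map] at h
  have key := D.diag_recursion (x := x) (y := y) (c := fun n => Zun n x y)
    (E := fun n => cornerZ n (D.fst (C x)) (D.fst (C y)) (D.fst X) (D.snd X))
    (S := fun n => Zsing (n + 1) (C x) (C y) X) hZ h N 1
  rw [D.diag_sumPow_mul_cornerZ] at key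
  rw [cornerZ_one_one (N + 1), key, mul_add, mul_one]

lemma zun_recursion_of_params {K : Type*} [Field K] {q s x y : K} (hq : q ≠ 0) (hs : s ≠ 0)
    (hq1 : q ^ 2 - 1 ≠ 0) (hx : x = s ^ 2) (hy : y * q = (1 - s * q) * (q - s)) (hy0 : y ≠ 0)
    (hZ : ∀ n, Zun n x y ≠ 0) (N : ℕ) :
    Zun (N + 2) x y = Zun (N + 1) x y * (1 + ∑ k ∈ range (N + 1),
      (y ^ (k + 1) * (((N + 1).choose (k + 1) : ℕ) : K) ^ 2 +
        (x * y ^ k *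
            (∑ j ∈ range (N - k + 1), ((N - j).choose k : K) * Zcoeff (N - k + 1) j x y) ^ 2 -
          y ^ (k + 1) * (∑ j ∈ range (N - k + 1),
            ((N + 1 - j).choose (k + 1) : K) * Zcoeff (N - k + 1) j x y) ^ 2) /
          (Zun (N - k + 1) x y * Zun (N - k) x y))) := by
  rw [(diagonalCoeffPowerSeries K).zun_recursion hq hs hq1 hx hy hy0 hZ N]
  refine congrArg (fun a => Zun (N + 1) x y * (1 + a)) (Finset.sum_congr rfl fun k hk => ?_)
  have hk' : k ≤ N := Nat.lt_succ_iff.1 (Finset.mem_range.1 hk)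
  have e1 (m d : ℕ) :
      coeff m ((PowerSeries.mk 1 : K⟦X⟧) ^ (d + 1)) = ((d + m).choose d : K) := by
    rw [mk_one_pow_eq_mk_choose_add, coeff_mk]
  simp only [recursionTerm, coeff_mul_zsing, add_comm 1 k, e1]
  rw [show k + 1 + (N - k) = N + 1 by omega]
  have e2 : ∀ j ∈ range (N - k + 1),
      ((k + (N - k - j)).choose k : K) * Zcoeff (N - k + 1) j x y =
        ((N - j).choose k : K) * Zcoeff (N - k + 1) j x y := fun j hj => by
    rw [show k + (N - k - j) = N - j by have := Finset.mem_range.1 hj; omega]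
  have e3 : ∀ j ∈ range (N - k + 1),
      ((k + 1 + (N - k - j)).choose (k + 1) : K) * Zcoeff (N - k + 1) j x y =
        ((N + 1 - j).choose (k + 1) : K) * Zcoeff (N - k + 1) j x y := fun j hj => by
    rw [show k + 1 + (N - k - j) = N + 1 - j by have := Finset.mem_range.1 hj; omega]
  rw [Finset.sum_congr rfl e2, Finset.sum_congr rfl e3]

lemma exists_params {K : Type*} [Field K] [IsAlgClosed K] [CharZero K] {x y : K} (hx : x ≠ 0)
    (hxy : (y - 1 - x) ^ 2 ≠ 4 * x) : ∃ q s : K, q ≠ 0 ∧ s ≠ 0 ∧ q ^ 2 - 1 ≠ 0 ∧ x = s ^ 2 ∧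
      y * q = (1 - s * q) * (q - s) := by
  obtain ⟨s, hs⟩ := IsAlgClosed.exists_eq_mul_self x
  have hs0 : s ≠ 0 := by
    rintro rfl
    exact hx (by rw [hs, mul_zero])
  obtain ⟨q, hq⟩ := exists_quadratic_eq_zero (b := -(1 + s ^ 2 - y)) (c := s) hs0
    (IsAlgClosed.exists_eq_mul_self _)
  refine ⟨q, s, ?_, hs0, fun h => ?_, by rw [hs, sq], by linear_combination hq⟩
  · rintro rfl
    exact hs0 (by linear_combination hq)
  · refine hxy ?_
    rw [hs]
    have h2 : (y - 1 - s * s) * q = -(2 * s) + s * (1 - q ^ 2) := by linear_combination hq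
    linear_combination ((y - 1 - s * s) * q + (-(2 * s) + s * (1 - q ^ 2))) * h2 +
      (-((y - 1 - s * s) ^ 2) + s ^ 2 * (q ^ 2 - 1 + 4)) * h

lemma zun_zero {R : Type*} [CommRing R] (x y : R) : Zun 0 x y = 1 := by
  rw [zun_eq, Fintype.sum_unique, if_pos]
  · simp [nuASM, muASM]
  · simp [isASM_iff]

lemma zun_one_one_pos (n : ℕ) : 0 < Zun n (1 : ℚ) 1 := by
  induction n with
  | zero =>
    rw [zun_zero]
    exact one_pos
  | succ n ih =>
    rw [cornerZ_one_one]
    refine add_pos_of_pos_of_nonneg ih (Finset.sum_nonneg fun e _ => ?_)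
    simp only [one_pow, mul_one]
    split_ifs
    exacts [zero_le_one, le_rfl]

lemma zun_recursion_choose {K : Type*} [Field K] [CharZero K] {x y : K} (hx : x ≠ 0) (hy : y ≠ 0)
    (hxy : (y - 1 - x) ^ 2 ≠ 4 * x) (hZ : ∀ n, Zun n x y ≠ 0) (N : ℕ) :
    Zun (N + 2) x y = Zun (N + 1) x y * (1 + ∑ k ∈ range (N + 1),
      (y ^ (k + 1) * (((N + 1).choose (k + 1) : ℕ) : K) ^ 2 +
        (x * y ^ k *
            (∑ j ∈ range (N - k + 1), ((N - j).choose k : K) * Zcoeff (N - k + 1) j x y) ^ 2 -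
          y ^ (k + 1) * (∑ j ∈ range (N - k + 1),
            ((N + 1 - j).choose (k + 1) : K) * Zcoeff (N - k + 1) j x y) ^ 2) /
          (Zun (N - k + 1) x y * Zun (N - k) x y))) := by
  obtain ⟨L, hL, hL0, hL1, φ⟩ : ∃ (L : Type _) (_ : Field L) (_ : IsAlgClosed L) (_ : CharZero L),
      Nonempty (K →+* L) := ⟨AlgebraicClosure K, inferInstance, inferInstance,
    charZero_of_injective_algebraMap (algebraMap K (AlgebraicClosure K)).injective,
    ⟨algebraMap K (AlgebraicClosure K)⟩⟩
  obtain ⟨φ⟩ := φ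
  have hφ := φ.injective
  obtain ⟨q, s, hq, hs, hq1, hx', hy'⟩ := exists_params (x := φ x) (y := φ y)
    ((map_ne_zero φ).2 hx) fun h => hxy (hφ (by simpa [map_ofNat φ 4] using h))
  have key := zun_recursion_of_params hq hs hq1 hx' hy' ((map_ne_zero φ).2 hy)
    (fun n => by
      rw [Zun_map]
      exact (map_ne_zero φ).2 (hZ n)) N
  apply hφ
  simpa only [map_mul, map_add, map_sub, map_one, map_sum, map_pow, map_div₀, map_natCast,
    ← Zun_map, ← Zcoeff_map] using key

lemma ibinom_natCast (a b : ℕ) : ibinom a b = a.choose b := by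
  rw [ibinom]
  split_ifs with h
  · simp
  · rw [Nat.choose_eq_zero_of_lt (by omega), Nat.cast_zero]

lemma zun_recursion_ibinom {K : Type*} [Field K] [CharZero K] {x y : K} (hx : x ≠ 0)
    (hy : y ≠ 0) (hxy : (y - 1 - x) ^ 2 ≠ 4 * x) (hZ : ∀ n, Zun n x y ≠ 0) {n : ℕ} (hn : 2 ≤ n) :
    Zun n x y =
      Zun (n - 1) x y *
        (1 + ∑ i ∈ Finset.range (n - 1),
          (y ^ (i + 1) * (ibinom ((n : ℤ) - 1) ((i : ℤ) + 1) : K) ^ 2 +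
           (x * y ^ i *
                (∑ j ∈ Finset.range (n - i - 1),
                  (ibinom ((n : ℤ) - j - 2) (i : ℤ) : K) *
                    Zcoeff (n - i - 1) j x y) ^ 2 -
            y ^ (i + 1) *
                (∑ j ∈ Finset.range (n - i - 1),
                  (ibinom ((n : ℤ) - j - 1) ((i : ℤ) + 1) : K) *
                    Zcoeff (n - i - 1) j x y) ^ 2) /
            (Zun (n - i - 1) x y * Zun (n - i - 2) x y))) := by
  obtain ⟨N, rfl⟩ := Nat.exists_eq_add_of_le' hn
  rw [show N + 2 - 1 = N + 1 by omega, zun_recursion_choose hx hy hxy hZ N]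
  refine congrArg (fun a => Zun (N + 1) x y * (1 + a)) (Finset.sum_congr rfl fun k hk => ?_)
  have hk' : k ≤ N := Nat.lt_succ_iff.1 (Finset.mem_range.1 hk)
  have e0 : ibinom (((N + 2 : ℕ) : ℤ) - 1) ((k : ℤ) + 1) = (N + 1).choose (k + 1) := by
    rw [← ibinom_natCast]
    congr 1
    omega
  have e1 : ∀ j ∈ range (N - k + 1),
      (ibinom (((N + 2 : ℕ) : ℤ) - j - 2) (k : ℤ) : K) * Zcoeff (N - k + 1) j x y =
        ((N - j).choose k : K) * Zcoeff (N - k + 1) j x y := fun j hj => by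
    have := Finset.mem_range.1 hj
    have e : ibinom (((N + 2 : ℕ) : ℤ) - j - 2) (k : ℤ) = (N - j).choose k := by
      rw [← ibinom_natCast]
      congr 1
      omega
    rw [e, Int.cast_natCast]
  have e2 : ∀ j ∈ range (N - k + 1),
      (ibinom (((N + 2 : ℕ) : ℤ) - j - 1) ((k : ℤ) + 1) : K) * Zcoeff (N - k + 1) j x y =
        ((N + 1 - j).choose (k + 1) : K) * Zcoeff (N - k + 1) j x y := fun j hj => by
    have := Finset.mem_range.1 hj
    have e : ibinom (((N + 2 : ℕ) : ℤ) - j - 1) ((k : ℤ) + 1) = (N + 1 - j).choose (k + 1) := by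
      rw [← ibinom_natCast]
      congr 1
      omega
    rw [e, Int.cast_natCast]
  rw [show N + 2 - k - 1 = N - k + 1 by omega, show N + 2 - k - 2 = N - k by omega, e0,
    Finset.sum_congr rfl e1, Finset.sum_congr rfl e2, Int.cast_natCast]

lemma injective_algebraMap_K2 : Function.Injective (algebraMap (MvPolynomial (Fin 2) ℚ) K2) :=
  IsFractionRing.injective _ _

lemma zun_vx_vy_ne_zero (n : ℕ) : Zun n vx vy ≠ 0 := by
  rw [vx, vy, Zun_map, map_ne_zero_iff _ injective_algebraMap_K2]
  intro h
  have h1 := congrArg (MvPolynomial.eval fun _ => (1 : ℚ)) h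
  rw [← Zun_map, MvPolynomial.eval_X, MvPolynomial.eval_X, map_zero] at h1
  exact (zun_one_one_pos n).ne' h1

lemma sq_vy_sub_ne : (vy - 1 - vx) ^ 2 ≠ 4 * vx := by
  intro h
  have h1 : (MvPolynomial.X 1 - 1 - MvPolynomial.X 0) ^ 2 =
      (4 * MvPolynomial.X 0 : MvPolynomial (Fin 2) ℚ) := injective_algebraMap_K2 (by
    rw [map_pow, map_sub, map_sub, map_one, map_mul, map_ofNat]
    exact h)
  have h2 := congrArg (MvPolynomial.eval fun _ => (0 : ℚ)) h1
  norm_num at h2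

/-- Recursion for the unrefined ASM generating function, as an identity in the
field of rational functions `ℚ(x,y)` (the convention `Z_0(x,y) = 1` holds
definitionally: `Zun 0 x y = 1`). -/
theorem stmt9 (n : ℕ) (hn : 2 ≤ n) :
    Zun n vx vy =
      Zun (n - 1) vx vy *
        (1 + ∑ i ∈ Finset.range (n - 1),
          (vy ^ (i + 1) * (ibinom ((n : ℤ) - 1) ((i : ℤ) + 1) : K2) ^ 2 +
           (vx * vy ^ i *
                (∑ j ∈ Finset.range (n - i - 1),
                  (ibinom ((n : ℤ) - j - 2) (i : ℤ) : K2) *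
                    Zcoeff (n - i - 1) j vx vy) ^ 2 -
            vy ^ (i + 1) *
                (∑ j ∈ Finset.range (n - i - 1),
                  (ibinom ((n : ℤ) - j - 1) ((i : ℤ) + 1) : K2) *
                    Zcoeff (n - i - 1) j vx vy) ^ 2) /
            (Zun (n - i - 1) vx vy * Zun (n - i - 2) vx vy))) := by
  exact zun_recursion_ibinom
    ((map_ne_zero_iff _ injective_algebraMap_K2).2 (MvPolynomial.X_ne_zero 0))
    ((map_ne_zero_iff _ injective_algebraMap_K2).2 (MvPolynomial.X_ne_zero 1)) sq_vy_sub_ne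
    zun_vx_vy_ne_zero hn
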